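/- Fix 0<c<∞, an integer d≥3, and an integer k≥1. For the KCIP on the torus Λ(L,d) with parameter p=c/n, the mixing time τ_{n,k} of the trace chain on Ω_k satisfies τ_{n,k} ≤ C·n^{2+2/d}·log(n) for a constant C depending only on c, k, d (not on n). -/

import Mathlib

open scoped Classical
open Finset

noncomputable section

/-- The number of particles (vertices labelled `1`) of a configuration. -/
def numParticles {V : Type*} [Fintype V] (x : V → Bool) : ℕ :=
  (Finset.univ.filter fun v => x v = true).card

/-- One-step transition kernel of the kinetically constrained Ising process (KCIP)
on the graph `G` with density parameter `p`: a uniformly chosen vertex `v` is updated,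
and its label is resampled (to `1` with probability `p`, to `0` otherwise) iff `v` has at
least one neighbour labelled `1`. -/
def kcipKernel {V : Type*} [Fintype V] (G : SimpleGraph V) (p : ℝ) (x y : V → Bool) : ℝ :=
  ((Fintype.card V : ℝ))⁻¹ * ∑ v : V,
    (if ∀ w, w ≠ v → y w = x w then
      (if ∃ u, G.Adj u v ∧ x u = true then (if y v = true then p else 1 - p)
       else (if y v = x v then 1 else 0))
     else 0)

/-- Probability that the Markov chain with kernel `K` started at `x` produces a
trajectory `(X_0, …, X_T)` lying in the event `A`. -/
def trajProb {Ω : Type*} [Fintype Ω] (K : Ω → Ω → ℝ) (x : Ω) (T : ℕ)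
    (A : (Fin (T + 1) → Ω) → Prop) : ℝ :=
  ∑ ω : Fin (T + 1) → Ω,
    if ω 0 = x ∧ A ω then ∏ i : Fin T, K (ω i.castSucc) (ω i.succ) else 0

/-- Expectation of a functional `f` of the trajectory `(X_0, …, X_T)` of the Markov chain
with kernel `K` started at `x`. -/
def trajExp {Ω : Type*} [Fintype Ω] (K : Ω → Ω → ℝ) (x : Ω) (T : ℕ)
    (f : (Fin (T + 1) → Ω) → ℝ) : ℝ :=
  ∑ ω : Fin (T + 1) → Ω,
    (if ω 0 = x then ∏ i : Fin T, K (ω i.castSucc) (ω i.succ) else 0) * f ω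

/-- The `d`-dimensional discrete torus `Z_L^d`: vertices are `Fin d → ZMod L`, with an edge
between `u` and `v` iff `u - v = ± e_i` for some coordinate vector `e_i`. -/
def torusGraph (L d : ℕ) : SimpleGraph (Fin d → ZMod L) :=
  SimpleGraph.fromRel fun u v => ∃ i : Fin d, v = u + fun j => if j = i then (1 : ZMod L) else 0

/-- `t`-step transition probabilities of the kernel `K`. -/
def kernelPow {Ω : Type*} [Fintype Ω] (K : Ω → Ω → ℝ) : ℕ → Ω → Ω → ℝ
  | 0 => fun x y => if x = y then 1 else 0
  | (t + 1) => fun x y => ∑ z, kernelPow K t x z * K z y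

/-- Total variation distance `sup_A (μ(A) - ν(A))` between two distributions on a finite set. -/
def tvDist {Ω : Type*} [Fintype Ω] (μ ν : Ω → ℝ) : ℝ :=
  ⨆ A : Finset Ω, (∑ y ∈ A, μ y - ∑ y ∈ A, ν y)

/-- Mixing time: the first time `t > 0` at which the total variation distance to `π`
is below `1/4`, uniformly in the starting state. -/
def mixingTime {Ω : Type*} [Fintype Ω] (K : Ω → Ω → ℝ) (π : Ω → ℝ) : ℕ :=
  sInf {t : ℕ | 0 < t ∧ ∀ x : Ω, tvDist (fun y => kernelPow K t x y) π < 1 / 4}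

/-- The stationary distribution of the KCIP:
`π(y) = p^{|y|} (1-p)^{n-|y|} 1_{|y|>0} / (1 - (1-p)^n)`. -/
def kcipStationary {V : Type*} [Fintype V] (p : ℝ) (y : V → Bool) : ℝ :=
  (if 0 < numParticles y then
      p ^ numParticles y * (1 - p) ^ (Fintype.card V - numParticles y)
    else 0) /
  (1 - (1 - p) ^ (Fintype.card V))

/-- `Ω_k`: configurations with exactly `k` particles, no two of which are adjacent. -/
def OmegaK {V : Type*} [Fintype V] (G : SimpleGraph V) (k : ℕ) : Set (V → Bool) :=
  {x | numParticles x = k ∧ ∀ u v, G.Adj u v → ¬(x u = true ∧ x v = true)}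

/-- Transition kernel of the trace of the KCIP on `Ω_k`: the probability that the first
visit of the chain to `Ω_k` after time `0` occurs at state `y`. -/
def traceKernel {V : Type*} [Fintype V] (G : SimpleGraph V) (p : ℝ) (k : ℕ)
    (x y : OmegaK G k) : ℝ :=
  ∑' t : ℕ, trajProb (kcipKernel G p) x.val (t + 1)
    (fun ω => ω (Fin.last (t + 1)) = y.val ∧
      ∀ s : Fin (t + 2), s ≠ 0 → s ≠ Fin.last (t + 1) → ω s ∉ OmegaK G k)

/-- The uniform distribution on a finite type. -/
def unifDist (Ω : Type*) [Fintype Ω] : Ω → ℝ := fun _ => ((Fintype.card Ω : ℝ))⁻¹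

section Mixing

variable {Ω : Type*} [Fintype Ω]

theorem sq_sum_le_of_lazy (w f : Ω → ℝ) (x : Ω) (hw : ∀ z, 0 ≤ w z)
    (hs : ∑ z, w z = 1) (hx : 1 / 2 ≤ w x) :
    (∑ z, w z * f z) ^ 2 ≤ ∑ z, w z * f z ^ 2 - 1 / 2 * ∑ z, w z * (f x - f z) ^ 2 := by
  have h1 : ∑ z, w z * f z = f x + ∑ z, w z * (f z - f x) := by
    simp only [mul_sub, Finset.sum_sub_distrib, ← Finset.sum_mul, hs]; ring
  have h2 : ∑ z, w z * f z ^ 2 = f x ^ 2 + 2 * f x * ∑ z, w z * (f z - f x)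
      + ∑ z, w z * (f x - f z) ^ 2 := by
    have : ∑ z, w z * (f x - f z) ^ 2
        = f x ^ 2 * ∑ z, w z - 2 * f x * ∑ z, w z * f z + ∑ z, w z * f z ^ 2 := by
      rw [Finset.mul_sum, Finset.mul_sum, ← Finset.sum_sub_distrib, ← Finset.sum_add_distrib]
      exact Finset.sum_congr rfl fun z _ => by ring
    rw [this, hs, h1]; ring
  have h3 : ∑ z, w z * (f z - f x) = ∑ z ∈ univ.erase x, w z * (f z - f x) := by
    rw [← Finset.add_sum_erase _ _ (Finset.mem_univ x)]; simp
  have h4 : ∑ z, w z * (f x - f z) ^ 2 = ∑ z ∈ univ.erase x, w z * (f x - f z) ^ 2 := by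
    rw [← Finset.add_sum_erase _ _ (Finset.mem_univ x)]; simp
  have h5 : ∑ z ∈ univ.erase x, w z ≤ 1 / 2 := by
    have := Finset.add_sum_erase univ w (Finset.mem_univ x)
    linarith
  have h6 := Finset.sum_sq_le_sum_mul_sum_of_sq_le_mul (univ.erase x)
    (r := fun z => w z * (f z - f x)) (f := w) (g := fun z => w z * (f x - f z) ^ 2)
    (fun z _ => hw z) (fun z _ => mul_nonneg (hw z) (sq_nonneg _)) (fun z _ => le_of_eq (by ring))
  have h7 : 0 ≤ ∑ z ∈ univ.erase x, w z * (f x - f z) ^ 2 :=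
    Finset.sum_nonneg fun z _ => mul_nonneg (hw z) (sq_nonneg _)
  rw [← h3, ← h4] at h6
  rw [← h4] at h7
  have h8 := mul_le_mul_of_nonneg_right h5 h7
  rw [h2, h1]
  nlinarith

theorem sum_sub_sq_of_sum_eq_zero (f : Ω → ℝ) (hf : ∑ x, f x = 0) :
    ∑ x, ∑ y, (f x - f y) ^ 2 = 2 * Fintype.card Ω * ∑ x, f x ^ 2 := by
  have : ∀ x, ∑ y, (f x - f y) ^ 2 = Fintype.card Ω * f x ^ 2 + ∑ y, f y ^ 2 := by
    intro x
    have : ∑ y, (f x - f y) ^ 2 = ∑ y, (f x ^ 2 - 2 * f x * f y + f y ^ 2) :=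
      Finset.sum_congr rfl fun y _ => by ring
    rw [this, Finset.sum_add_distrib, Finset.sum_sub_distrib, ← Finset.mul_sum, hf]
    simp
  simp only [this, Finset.sum_add_distrib, ← Finset.mul_sum]
  simp; ring

theorem sum_sq_contract (K : Ω → Ω → ℝ) (h0 : ∀ x y, 0 ≤ K x y) (hsymm : ∀ x y, K x y = K y x)
    (hrow : ∀ x, ∑ y, K x y = 1) (hlazy : ∀ x, 1 / 2 ≤ K x x) (A : ℝ) (hA : 0 < A)
    (hP : ∀ f : Ω → ℝ, ∑ x, ∑ y, (f x - f y) ^ 2 ≤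
      A * Fintype.card Ω * ∑ x, ∑ y, K x y * (f x - f y) ^ 2)
    (f : Ω → ℝ) (hf : ∑ x, f x = 0) :
    ∑ x, (∑ z, K x z * f z) ^ 2 ≤ (1 - 1 / A) * ∑ x, f x ^ 2 := by
  rcases isEmpty_or_nonempty Ω with hE | hE
  · simp
  have h1 : ∑ x, (∑ z, K x z * f z) ^ 2 ≤
      ∑ x, (∑ z, K x z * f z ^ 2 - 1 / 2 * ∑ z, K x z * (f x - f z) ^ 2) :=
    Finset.sum_le_sum fun x _ => sq_sum_le_of_lazy (K x) f x (h0 x) (hrow x) (hlazy x)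
  have h2 : ∑ x, ∑ z, K x z * f z ^ 2 = ∑ x, f x ^ 2 := by
    rw [Finset.sum_comm]
    refine Finset.sum_congr rfl fun z _ => ?_
    rw [← Finset.sum_mul, Finset.sum_congr rfl fun x _ => hsymm x z, hrow, one_mul]
  rw [Finset.sum_sub_distrib, h2, ← Finset.mul_sum] at h1
  have h3 := hP f
  rw [sum_sub_sq_of_sum_eq_zero f hf] at h3
  have hc : (0 : ℝ) < Fintype.card Ω := by exact_mod_cast Fintype.card_pos
  have h4 : 2 * ∑ x, f x ^ 2 ≤ A * ∑ x, ∑ y, K x y * (f x - f y) ^ 2 := by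
    refine le_of_mul_le_mul_left ?_ hc
    calc (Fintype.card Ω : ℝ) * (2 * ∑ x, f x ^ 2) = 2 * Fintype.card Ω * ∑ x, f x ^ 2 := by ring
      _ ≤ _ := h3
      _ = _ := by ring
  have h5 : 1 / A * (2 * ∑ x, f x ^ 2) ≤ ∑ x, ∑ y, K x y * (f x - f y) ^ 2 := by
    rw [one_div, inv_mul_le_iff₀ hA]; exact h4
  linarith

/-- Mass missing from a substochastic kernel, put on the diagonal. -/
def fillDiag (K : Ω → Ω → ℝ) (x y : Ω) : ℝ :=
  K x y + if x = y then 1 - ∑ z, K x z else 0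

theorem sum_fillDiag (K : Ω → Ω → ℝ) (x : Ω) : ∑ y, fillDiag K x y = 1 := by
  simp [fillDiag, Finset.sum_add_distrib]

theorem le_fillDiag (K : Ω → Ω → ℝ) (hrow : ∀ x, ∑ y, K x y ≤ 1) (x y : Ω) :
    K x y ≤ fillDiag K x y := by
  unfold fillDiag
  split_ifs
  · linarith [hrow x]
  · simp

theorem kernelPow_nonneg (K : Ω → Ω → ℝ) (h0 : ∀ x y, 0 ≤ K x y) (t : ℕ) :
    ∀ x y, 0 ≤ kernelPow K t x y := by
  induction t with
  | zero => intro x y; simp only [kernelPow]; split_ifs <;> norm_num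
  | succ t ih => intro x y; exact Finset.sum_nonneg fun z _ => mul_nonneg (ih x z) (h0 z y)

theorem kernelPow_mono {K K' : Ω → Ω → ℝ} (h0 : ∀ x y, 0 ≤ K x y) (h : ∀ x y, K x y ≤ K' x y)
    (t : ℕ) : ∀ x y, kernelPow K t x y ≤ kernelPow K' t x y := by
  induction t with
  | zero => intro x y; exact le_rfl
  | succ t ih =>
    intro x y
    exact Finset.sum_le_sum fun z _ => mul_le_mul (ih x z) (h z y) (h0 z y)
      ((kernelPow_nonneg K h0 t x z).trans (ih x z))

theorem kernelPow_l2 (K : Ω → Ω → ℝ) (h0 : ∀ x y, 0 ≤ K x y) (hsymm : ∀ x y, K x y = K y x)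
    (hrow : ∀ x, ∑ y, K x y = 1) (hlazy : ∀ x, 1 / 2 ≤ K x x) (A : ℝ) (hA : 1 ≤ A)
    (hP : ∀ f : Ω → ℝ, ∑ x, ∑ y, (f x - f y) ^ 2 ≤
      A * Fintype.card Ω * ∑ x, ∑ y, K x y * (f x - f y) ^ 2) (x : Ω) (t : ℕ) :
    ∑ y, (kernelPow K t x y - unifDist Ω y) = 0 ∧
      ∑ y, (kernelPow K t x y - unifDist Ω y) ^ 2 ≤ (1 - 1 / A) ^ t := by
  have hc : (0 : ℝ) < Fintype.card Ω := by
    exact_mod_cast Fintype.card_pos_iff.mpr ⟨x⟩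
  have hA' : 0 ≤ 1 - 1 / A := by
    rw [sub_nonneg, div_le_one (by linarith)]; exact hA
  induction t with
  | zero =>
    have h1 : ∑ y, kernelPow K 0 x y = 1 := by simp [kernelPow]
    have h2 : ∑ y, unifDist Ω y = 1 := by simp [unifDist, hc.ne']
    refine ⟨by rw [Finset.sum_sub_distrib, h1, h2, sub_self], ?_⟩
    have h3 : ∀ y, (kernelPow K 0 x y - unifDist Ω y) ^ 2 =
        kernelPow K 0 x y - 2 * (Fintype.card Ω : ℝ)⁻¹ * kernelPow K 0 x y
          + (Fintype.card Ω : ℝ)⁻¹ * unifDist Ω y := by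
      intro y
      simp only [kernelPow, unifDist]
      split_ifs <;> ring
    simp only [h3, Finset.sum_add_distrib, Finset.sum_sub_distrib, ← Finset.mul_sum, h1, h2]
    have := inv_pos.mpr hc
    rw [pow_zero]; linarith
  | succ t ih =>
    have h1 : ∀ y, kernelPow K (t + 1) x y - unifDist Ω y =
        ∑ z, K y z * (kernelPow K t x z - unifDist Ω z) := by
      intro y
      have : ∑ z, K y z * unifDist Ω z = unifDist Ω y := by
        simp only [unifDist]; rw [← Finset.sum_mul, hrow, one_mul]
      simp only [mul_sub, Finset.sum_sub_distrib, this, kernelPow]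
      congr 1
      exact Finset.sum_congr rfl fun z _ => by rw [hsymm z y, mul_comm]
    constructor
    · simp only [h1]
      rw [Finset.sum_comm, ← ih.1]
      refine Finset.sum_congr rfl fun z _ => ?_
      rw [← Finset.sum_mul, Finset.sum_congr rfl fun y _ => hsymm y z, hrow, one_mul]
    · simp only [h1]
      refine (sum_sq_contract K h0 hsymm hrow hlazy A (by linarith) hP _ ih.1).trans ?_
      rw [pow_succ']
      exact mul_le_mul_of_nonneg_left ih.2 hA'

theorem mixingTime_le_of_poincare (K : Ω → Ω → ℝ) (h0 : ∀ x y, 0 ≤ K x y)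
    (hsymm : ∀ x y, K x y = K y x) (hrow : ∀ x, ∑ y, K x y ≤ 1) (hlazy : ∀ x, 1 / 2 ≤ K x x)
    (A : ℝ) (hA : 1 ≤ A)
    (hP : ∀ f : Ω → ℝ, ∑ x, ∑ y, (f x - f y) ^ 2 ≤
      A * Fintype.card Ω * ∑ x, ∑ y, K x y * (f x - f y) ^ 2) (t : ℕ) (ht : 0 < t)
    (hsmall : (Fintype.card Ω : ℝ) * (1 - 1 / A) ^ t < 1 / 16) :
    mixingTime K (unifDist Ω) ≤ t := by
  refine Nat.sInf_le ⟨ht, fun x => ?_⟩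
  have hle := le_fillDiag K hrow
  have key := (kernelPow_l2 (fillDiag K) (fun x y => (h0 x y).trans (hle x y))
    (fun x y => by
      by_cases h : x = y
      · rw [h]
      · simp [fillDiag, h, Ne.symm h, hsymm x y])
    (sum_fillDiag K) (fun x => (hlazy x).trans (hle x x)) A hA
    (fun f => (hP f).trans (mul_le_mul_of_nonneg_left
      (Finset.sum_le_sum fun x _ => Finset.sum_le_sum fun y _ =>
        mul_le_mul_of_nonneg_right (hle x y) (sq_nonneg _)) (by positivity))) x t).2
  have hbound : tvDist (fun y => kernelPow K t x y) (unifDist Ω) ≤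
      √((Fintype.card Ω : ℝ) * (1 - 1 / A) ^ t) := by
    refine ciSup_le fun B => ?_
    have hB : ∑ y ∈ B, kernelPow K t x y - ∑ y ∈ B, unifDist Ω y ≤
        ∑ y ∈ B, (kernelPow (fillDiag K) t x y - unifDist Ω y) := by
      rw [← Finset.sum_sub_distrib]
      exact Finset.sum_le_sum fun y _ => sub_le_sub_right (kernelPow_mono h0 hle t x y) _
    refine hB.trans (Real.le_sqrt_of_sq_le ?_)
    refine sq_sum_le_card_mul_sum_sq.trans ?_
    refine mul_le_mul (by exact_mod_cast Finset.card_le_univ B) ?_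
      (Finset.sum_nonneg fun _ _ => sq_nonneg _) (by positivity)
    exact (Finset.sum_le_sum_of_subset_of_nonneg (Finset.subset_univ B)
      fun _ _ _ => sq_nonneg _).trans key
  refine hbound.trans_lt ?_
  rw [Real.sqrt_lt' (by norm_num)]
  norm_num at hsmall ⊢
  exact hsmall

end Mixing

section FirstReturn

variable {S : Type*} [Fintype S]

theorem trajProb_congr (P : S → S → ℝ) (x : S) (T : ℕ) {A B : (Fin (T + 1) → S) → Prop}
    (h : ∀ ω, ω 0 = x → (A ω ↔ B ω)) : trajProb P x T A = trajProb P x T B := by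
  unfold trajProb
  refine Finset.sum_congr rfl fun ω _ => ?_
  by_cases h1 : ω 0 = x
  · simp only [h1, true_and, h ω h1]
  · simp only [h1, false_and]

theorem trajProb_zero (P : S → S → ℝ) (x : S) (A : (Fin 1 → S) → Prop) :
    trajProb P x 0 A = if A (fun _ => x) then 1 else 0 := by
  unfold trajProb
  rw [Finset.sum_eq_single (fun _ => x)]
  · simp
  · intro ω _ hω
    rw [if_neg]
    rintro ⟨h1, -⟩
    exact hω (funext fun i => by rw [Subsingleton.elim (α := Fin 1) i 0]; exact h1)
  · simp

theorem trajProb_succ (P : S → S → ℝ) (x : S) (T : ℕ) (A : (Fin (T + 2) → S) → Prop) :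
    trajProb P x (T + 1) A =
      ∑ z, P x z * trajProb P z T (fun ω => A (Fin.cons x ω : Fin (T + 2) → S)) := by
  unfold trajProb
  rw [← (Fin.consEquiv (fun _ : Fin (T + 2) => S)).sum_comp, Fintype.sum_prod_type]
  have hcons : ∀ z ω, (Fin.consEquiv (fun _ : Fin (T + 2) => S)) (z, ω) = Fin.cons z ω :=
    fun _ _ => rfl
  simp only [hcons]
  rw [Finset.sum_eq_single x]
  · simp only [Finset.mul_sum]
    rw [Finset.sum_comm]
    refine Finset.sum_congr rfl fun ω _ => ?_
    rw [Finset.sum_eq_single (ω 0)]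
    · rw [Fin.prod_univ_succ]
      simp only [Fin.castSucc_zero, Fin.cons_zero, Fin.cons_succ, ← Fin.succ_castSucc, true_and]
      split_ifs <;> simp
    · intro z _ hz
      rw [if_neg (fun h => hz h.1.symm), mul_zero]
    · simp
  · intro z _ hz
    refine Finset.sum_eq_zero fun ω _ => ?_
    rw [if_neg]
    rintro ⟨h, -⟩
    exact hz (by simpa using h)
  · simp

theorem trajProb_and_left (P : S → S → ℝ) (x : S) (T : ℕ) (q : Prop) [Decidable q]
    (A : (Fin (T + 1) → S) → Prop) :
    trajProb P x T (fun ω => q ∧ A ω) = if q then trajProb P x T A else 0 := by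
  by_cases hq : q
  · rw [if_pos hq]
    exact trajProb_congr P x T fun ω _ => by simp [hq]
  · rw [if_neg hq]
    unfold trajProb
    exact Finset.sum_eq_zero fun ω _ => if_neg fun h => hq h.2.1

theorem trajProb_nonneg (P : S → S → ℝ) (h0 : ∀ x y, 0 ≤ P x y) (x : S) (T : ℕ)
    (A : (Fin (T + 1) → S) → Prop) : 0 ≤ trajProb P x T A := by
  unfold trajProb
  refine Finset.sum_nonneg fun ω _ => ?_
  split_ifs
  · exact Finset.prod_nonneg fun i _ => h0 _ _
  · exact le_rfl

/-- Probability that the chain started at `x` first visits `Z` after time `0` at time `t + 1`,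
and does so at `y`. -/
def firstVisit (P : S → S → ℝ) (Z : Set S) (t : ℕ) (x y : S) : ℝ :=
  trajProb P x (t + 1) (fun ω => ω (Fin.last (t + 1)) = y ∧
    ∀ s : Fin (t + 2), s ≠ 0 → s ≠ Fin.last (t + 1) → ω s ∉ Z)

theorem firstVisit_nonneg (P : S → S → ℝ) (h0 : ∀ x y, 0 ≤ P x y) (Z : Set S) (t : ℕ) (x y : S) :
    0 ≤ firstVisit P Z t x y :=
  trajProb_nonneg P h0 _ _ _

theorem firstVisit_zero (P : S → S → ℝ) (Z : Set S) (x y : S) :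
    firstVisit P Z 0 x y = P x y := by
  unfold firstVisit
  rw [trajProb_succ, Finset.sum_eq_single y]
  · rw [trajProb_zero, if_pos, mul_one]
    refine ⟨rfl, fun s h1 h2 => ?_⟩
    fin_cases s
    · exact absurd rfl h1
    · exact absurd rfl h2
  · intro z _ hz
    rw [trajProb_zero, if_neg, mul_zero]
    exact fun h => hz h.1
  · simp

theorem firstVisit_succ (P : S → S → ℝ) (Z : Set S) (t : ℕ) (x y : S) :
    firstVisit P Z (t + 1) x y = ∑ z, P x z * (if z ∉ Z then firstVisit P Z t z y else 0) := by
  unfold firstVisit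
  rw [trajProb_succ]
  refine Finset.sum_congr rfl fun z _ => ?_
  rw [← trajProb_and_left]
  congr 1
  refine trajProb_congr _ _ _ fun ω hω => ?_
  rw [← Fin.succ_last, Fin.cons_succ, Fin.forall_fin_succ]
  simp only [ne_eq, not_true_eq_false, false_imp_iff, true_and, Fin.cons_succ,
    Fin.succ_ne_zero, not_false_eq_true, true_imp_iff, Fin.succ_inj]
  constructor
  · rintro ⟨h1, h2⟩
    exact ⟨hω ▸ h2 0 Fin.last_pos.ne, h1, fun s _ hs => h2 s hs⟩
  · rintro ⟨h1, h2, h3⟩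
    refine ⟨h2, fun s hs => ?_⟩
    by_cases h : s = 0
    · rw [h, hω]; exact h1
    · exact h3 s h hs

theorem sum_firstVisit_le_one (P : S → S → ℝ) (h0 : ∀ x y, 0 ≤ P x y)
    (hrow : ∀ x, ∑ y, P x y ≤ 1) (Z : Set S) (T : ℕ) :
    ∀ x, ∑ t ∈ Finset.range T, ∑ y, (if y ∈ Z then firstVisit P Z t x y else 0) ≤ 1 := by
  induction T with
  | zero => intro x; simp
  | succ T ih =>
    intro x
    rw [Finset.sum_range_succ']
    simp only [firstVisit_zero, firstVisit_succ]
    have : ∑ t ∈ Finset.range T, ∑ y, (if y ∈ Z then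
        ∑ z, P x z * (if z ∉ Z then firstVisit P Z t z y else 0) else 0) =
        ∑ z, P x z * (if z ∉ Z then ∑ t ∈ Finset.range T, ∑ y,
          (if y ∈ Z then firstVisit P Z t z y else 0) else 0) := by
      have h1 : ∀ t y, (if y ∈ Z then
        ∑ z, P x z * (if z ∉ Z then firstVisit P Z t z y else 0) else 0) =
        ∑ z, P x z * (if z ∉ Z then (if y ∈ Z then firstVisit P Z t z y else 0) else 0) := by
        intro t y
        split_ifs
        · rfl
        · simp
      simp only [h1]
      rw [Finset.sum_congr rfl fun t _ => Finset.sum_comm, Finset.sum_comm]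
      refine Finset.sum_congr rfl fun z _ => ?_
      simp only [← Finset.mul_sum]
      by_cases hz : z ∈ Z <;> simp [hz]
    rw [this, ← Finset.sum_add_distrib]
    refine (Finset.sum_le_sum fun z _ => ?_).trans (hrow x)
    by_cases hz : z ∈ Z
    · simp [hz]
    · simp only [hz, not_false_eq_true, if_true, if_false, add_zero]
      exact mul_le_of_le_one_right (h0 x z) (ih z)

theorem firstVisit_detailed_balance (P : S → S → ℝ) (π : S → ℝ)
    (hrev : ∀ x y, π x * P x y = π y * P y x) (Z : Set S) (t : ℕ) (x y : S) :
    π x * firstVisit P Z t x y = π y * firstVisit P Z t y x := by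
  have hpath : ∀ (T : ℕ) (ω : Fin (T + 1) → S),
      π (ω 0) * ∏ i : Fin T, P (ω i.castSucc) (ω i.succ) =
      π (ω (Fin.last T)) * ∏ i : Fin T, P (ω i.succ) (ω i.castSucc) := by
    intro T
    induction T with
    | zero => intro ω; simp
    | succ T ih =>
      intro ω
      have := ih (fun i => ω i.castSucc)
      rw [Fin.prod_univ_castSucc, Fin.prod_univ_castSucc, ← mul_assoc]
      simp only [Fin.castSucc_zero] at this
      simp only [Fin.succ_castSucc, Fin.succ_last] at this ⊢
      rw [this, mul_right_comm, hrev]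
      ring
  unfold firstVisit trajProb
  rw [Finset.mul_sum, Finset.mul_sum,
    ← (Equiv.arrowCongr (Fin.revPerm (n := t + 2)) (Equiv.refl S)).sum_comp]
  refine Finset.sum_congr rfl fun ω _ => ?_
  have hval : ∀ i, (Equiv.arrowCongr (Fin.revPerm (n := t + 2)) (Equiv.refl S)) ω i
    = ω i.rev := fun i => rfl
  simp only [hval]
  have hprod : ∏ i : Fin (t + 1), P (ω i.castSucc.rev) (ω i.succ.rev) =
      ∏ i : Fin (t + 1), P (ω i.succ) (ω i.castSucc) := by
    rw [← Equiv.prod_comp (Fin.revPerm (n := t + 1))]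
    simp [Fin.rev_castSucc, Fin.rev_succ]
  have hc : (ω (Fin.rev 0) = x ∧ ω (Fin.last (t + 1)).rev = y ∧
      ∀ s : Fin (t + 2), s ≠ 0 → s ≠ Fin.last (t + 1) → ω s.rev ∉ Z) ↔
      (ω 0 = y ∧ ω (Fin.last (t + 1)) = x ∧
      ∀ s : Fin (t + 2), s ≠ 0 → s ≠ Fin.last (t + 1) → ω s ∉ Z) := by
    rw [Fin.rev_zero, Fin.rev_last]
    constructor
    · rintro ⟨h1, h2, h3⟩
      refine ⟨h2, h1, fun s hs hs' => ?_⟩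
      have := h3 s.rev (fun h => hs' ?_) (fun h => hs ?_)
      · rwa [Fin.rev_rev] at this
      · rw [← Fin.rev_rev s, h, Fin.rev_zero]
      · rw [← Fin.rev_rev s, h, Fin.rev_last]
    · rintro ⟨h1, h2, h3⟩
      refine ⟨h2, h1, fun s hs hs' => h3 s.rev (fun h => hs' ?_) (fun h => hs ?_)⟩
      · rw [← Fin.rev_rev s, h, Fin.rev_zero]
      · rw [← Fin.rev_rev s, h, Fin.rev_last]
  by_cases h : ω 0 = y ∧ ω (Fin.last (t + 1)) = x ∧
      ∀ s : Fin (t + 2), s ≠ 0 → s ≠ Fin.last (t + 1) → ω s ∉ Z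
  · rw [if_pos (hc.mpr h), if_pos h, hprod]
    have := hpath (t + 1) ω
    rw [h.1, h.2.1] at this
    exact this.symm
  · rw [if_neg (fun h' => h (hc.mp h')), if_neg h, mul_zero, mul_zero]

theorem pow_mul_le_firstVisit (P : S → S → ℝ) (h0 : ∀ x y, 0 ≤ P x y) (Z : Set S) (w y : S)
    (hw : w ∉ Z) (t : ℕ) : P w w ^ t * P w y ≤ firstVisit P Z t w y := by
  induction t with
  | zero => simp [firstVisit_zero]
  | succ t ih =>
    rw [firstVisit_succ, pow_succ', mul_assoc]
    refine (mul_le_mul_of_nonneg_left ih (h0 w w)).trans ?_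
    refine le_trans (le_of_eq ?_) (Finset.single_le_sum (fun z _ => mul_nonneg (h0 w z) ?_)
      (Finset.mem_univ w))
    · rw [if_pos hw]
    · split_ifs
      · exact le_rfl
      · exact firstVisit_nonneg P h0 Z t z y

theorem summable_firstVisit (P : S → S → ℝ) (h0 : ∀ x y, 0 ≤ P x y)
    (hrow : ∀ x, ∑ y, P x y ≤ 1) (Z : Set S) (x y : S) (hy : y ∈ Z) :
    Summable fun t => firstVisit P Z t x y := by
  refine summable_of_sum_range_le (c := 1) (fun t => firstVisit_nonneg P h0 Z t x y) fun T => ?_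
  refine (Finset.sum_le_sum fun t _ => ?_).trans (sum_firstVisit_le_one P h0 hrow Z T x)
  refine le_trans (le_of_eq (if_pos hy).symm) (Finset.single_le_sum
    (f := fun y => if y ∈ Z then firstVisit P Z t x y else 0) (fun z _ => ?_)
    (Finset.mem_univ y))
  split_ifs
  · exact firstVisit_nonneg P h0 Z t x z
  · exact le_rfl

theorem sum_tsum_firstVisit_le_one (P : S → S → ℝ) (h0 : ∀ x y, 0 ≤ P x y)
    (hrow : ∀ x, ∑ y, P x y ≤ 1) (Z : Set S) (x : S) :
    ∑ y : Z, ∑' t, firstVisit P Z t x y ≤ 1 := by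
  rw [← Summable.tsum_finsetSum (f := fun (y : Z) t => firstVisit P Z t x y)
    fun y _ => summable_firstVisit P h0 hrow Z x y y.2]
  refine Real.tsum_le_of_sum_range_le
    (fun t => Finset.sum_nonneg fun y _ => firstVisit_nonneg P h0 Z t x y) fun T => ?_
  refine le_trans (le_of_eq ?_) (sum_firstVisit_le_one P h0 hrow Z T x)
  refine Finset.sum_congr rfl fun t _ => ?_
  rw [← Finset.sum_filter]
  exact (Finset.sum_subtype _ (by simp) _).symm

/-- A jump through an intermediate state `w ∉ Z` that is left at rate at most `δ`. -/
theorem tsum_firstVisit_ge (P : S → S → ℝ) (h0 : ∀ x y, 0 ≤ P x y)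
    (hrow : ∀ x, ∑ y, P x y ≤ 1) (Z : Set S) (x w y : S) (hw : w ∉ Z) (hy : y ∈ Z)
    (hpos : 0 < P w y) (δ : ℝ) (hδ : 1 - P w w ≤ δ) :
    P x w * P w y / δ ≤ ∑' t, firstVisit P Z t x y := by
  have hlt : P w w < 1 := by
    have hne : w ≠ y := fun h => hw (h ▸ hy)
    have h1 : ∑ z ∈ {w, y}, P w z ≤ ∑ z, P w z :=
      Finset.sum_le_sum_of_subset_of_nonneg (Finset.subset_univ _) fun z _ _ => h0 w z
    rw [Finset.sum_pair hne] at h1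
    linarith [hrow w]
  have hs := summable_firstVisit P h0 hrow Z x y hy
  have hs' : Summable fun t => firstVisit P Z (t + 1) x y :=
    (summable_nat_add_iff (f := fun t => firstVisit P Z t x y) 1).mpr hs
  have hg := summable_geometric_of_lt_one (h0 w w) hlt
  have hle : ∀ t, P w w ^ t * (P x w * P w y) ≤ firstVisit P Z (t + 1) x y := by
    intro t
    rw [firstVisit_succ]
    have h1 := mul_le_mul_of_nonneg_left (pow_mul_le_firstVisit P h0 Z w y hw t) (h0 x w)
    refine le_trans (le_of_eq (by ring)) (h1.trans ?_)
    refine le_trans (le_of_eq ?_) (Finset.single_le_sum (fun z _ => mul_nonneg (h0 x z) ?_)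
      (Finset.mem_univ w))
    · rw [if_pos hw]
    · split_ifs
      · exact le_rfl
      · exact firstVisit_nonneg P h0 Z t z y
  have h2 := (hg.mul_right (P x w * P w y)).tsum_le_tsum hle hs'
  rw [tsum_mul_right, tsum_geometric_of_lt_one (h0 w w) hlt] at h2
  have h3 := firstVisit_nonneg P h0 Z 0 x y
  rw [hs.tsum_eq_zero_add]
  refine le_trans ?_ (h2.trans (le_add_of_nonneg_left h3))
  rw [div_eq_inv_mul]
  exact mul_le_mul_of_nonneg_right (inv_anti₀ (by linarith) hδ) (mul_nonneg (h0 _ _) (h0 _ _))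

end FirstReturn

section Kernel

variable {V : Type*} [Fintype V] (G : SimpleGraph V) (p : ℝ)

theorem sum_ite_eq_off (v : V) (x : V → Bool) (h : (V → Bool) → ℝ) :
    ∑ y : V → Bool, (if ∀ w, w ≠ v → y w = x w then h y else 0) =
      h (Function.update x v true) + h (Function.update x v false) := by
  have hne : Function.update x v true ≠ Function.update x v false := by
    intro h
    have := congrFun h v
    simp at this
  rw [← Finset.sum_pair hne, ← Finset.sum_filter]
  congr 1
  ext y
  simp only [Finset.mem_filter, Finset.mem_univ, true_and, Finset.mem_insert,
    Finset.mem_singleton]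
  constructor
  · intro hy
    have : y = Function.update x v (y v) := by
      funext w
      by_cases hw : w = v
      · subst hw; simp
      · rw [Function.update_of_ne hw, hy w hw]
    rcases hb : y v with _ | _
    · right; rw [← hb]; exact this
    · left; rw [← hb]; exact this
  · rintro (rfl | rfl) w hw <;> rw [Function.update_of_ne hw]

theorem kcipKernel_nonneg (hp0 : 0 ≤ p) (hp1 : p ≤ 1) (x y : V → Bool) :
    0 ≤ kcipKernel G p x y := by
  unfold kcipKernel
  refine mul_nonneg (by positivity) (Finset.sum_nonneg fun v _ => ?_)
  have : 0 ≤ 1 - p := by linarith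
  split_ifs <;> first | assumption | norm_num

theorem kcipKernel_row (x : V → Bool) : ∑ y, kcipKernel G p x y ≤ 1 := by
  unfold kcipKernel
  rw [← Finset.mul_sum, Finset.sum_comm]
  have : ∀ v : V, ∑ y : V → Bool, (if ∀ w, w ≠ v → y w = x w then
      (if ∃ u, G.Adj u v ∧ x u = true then (if y v = true then p else 1 - p)
       else (if y v = x v then 1 else 0))
     else 0) = (1 : ℝ) := by
    intro v
    rw [sum_ite_eq_off]
    by_cases hc : ∃ u, G.Adj u v ∧ x u = true
    · simp [hc]
    · rcases hx : x v with _ | _ <;> simp [hc]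
  simp only [this]
  simp only [Finset.sum_const, Finset.card_univ, nsmul_eq_mul, mul_one]
  exact inv_mul_le_one

/-- Unnormalised reversible measure of the KCIP. -/
def bernoulliWeight (x : V → Bool) : ℝ := ∏ v, if x v = true then p else 1 - p

theorem kcipKernel_reversible (x y : V → Bool) :
    bernoulliWeight p x * kcipKernel G p x y = bernoulliWeight p y * kcipKernel G p y x := by
  unfold kcipKernel
  rw [mul_left_comm, mul_left_comm (bernoulliWeight p y)]
  congr 1
  rw [Finset.mul_sum, Finset.mul_sum]
  refine Finset.sum_congr rfl fun v _ => ?_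
  by_cases h : ∀ w, w ≠ v → y w = x w
  · have h' : ∀ w, w ≠ v → x w = y w := fun w hw => (h w hw).symm
    have hc : (∃ u, G.Adj u v ∧ x u = true) ↔ (∃ u, G.Adj u v ∧ y u = true) := by
      constructor
      · rintro ⟨u, h1, h2⟩
        exact ⟨u, h1, by rw [h u h1.ne, h2]⟩
      · rintro ⟨u, h1, h2⟩
        exact ⟨u, h1, by rw [h' u h1.ne, h2]⟩
    rw [if_pos h, if_pos h']
    simp only [hc]
    by_cases h1 : ∃ u, G.Adj u v ∧ y u = true
    · have hw : ∏ w ∈ univ.erase v, (if x w = true then p else 1 - p) =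
          ∏ w ∈ univ.erase v, (if y w = true then p else 1 - p) :=
        Finset.prod_congr rfl fun w hw => by rw [h' w (Finset.ne_of_mem_erase hw)]
      rw [if_pos h1, if_pos h1, bernoulliWeight, bernoulliWeight,
        ← Finset.mul_prod_erase _ _ (Finset.mem_univ v),
        ← Finset.mul_prod_erase univ (fun w => if y w = true then p else 1 - p)
          (Finset.mem_univ v), hw]
      ring
    · rw [if_neg h1, if_neg h1]
      by_cases h2 : y v = x v
      · have : y = x := funext fun w => by
          by_cases hw : w = v
          · rw [hw, h2]
          · exact h w hw
        rw [this]
      · rw [if_neg h2, if_neg (Ne.symm h2), mul_zero, mul_zero]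
  · have h' : ¬ ∀ w, w ≠ v → x w = y w := fun h' => h fun w hw => (h' w hw).symm
    rw [if_neg h, if_neg h', mul_zero, mul_zero]

theorem bernoulliWeight_eq (x : V → Bool) :
    bernoulliWeight p x = p ^ numParticles x * (1 - p) ^ (Fintype.card V - numParticles x) := by
  unfold bernoulliWeight numParticles
  rw [Finset.prod_ite, Finset.prod_const, Finset.prod_const]
  congr 2
  rw [← Finset.card_compl]
  congr 1
  ext v
  simp

/-- Vertices with a neighbour labelled `1`. -/
def unblocked (x : V → Bool) : Finset V := univ.filter fun v => ∃ u, G.Adj u v ∧ x u = true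

theorem one_sub_kcipKernel_self_le [Nonempty V] (hp0 : 0 ≤ p) (hp1 : p ≤ 1) (x : V → Bool) :
    1 - kcipKernel G p x x ≤ (unblocked G x).card / Fintype.card V := by
  have hc : (0 : ℝ) < Fintype.card V := by exact_mod_cast Fintype.card_pos
  rw [le_div_iff₀ hc, sub_mul, kcipKernel, mul_right_comm, inv_mul_cancel₀ hc.ne', one_mul, one_mul,
    sub_le_iff_le_add, ← Finset.card_univ, Finset.cast_card, Finset.cast_card, unblocked,
    Finset.sum_filter, ← Finset.sum_add_distrib]
  refine Finset.sum_le_sum fun v _ => ?_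
  have : 0 ≤ 1 - p := by linarith
  split_ifs <;> simp_all

theorem kcipKernel_ge_of_unblocked (hp0 : 0 ≤ p) (hp1 : p ≤ 1) (x y : V → Bool) (v : V)
    (hu : ∃ u, G.Adj u v ∧ x u = true) (hy : ∀ w, w ≠ v → y w = x w) :
    (Fintype.card V : ℝ)⁻¹ * (if y v = true then p else 1 - p) ≤ kcipKernel G p x y := by
  unfold kcipKernel
  refine mul_le_mul_of_nonneg_left ?_ (by positivity)
  have : 0 ≤ 1 - p := by linarith
  refine le_trans (le_of_eq ?_) (Finset.single_le_sum (fun w _ => ?_) (Finset.mem_univ v))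
  · rw [if_pos hy, if_pos hu]
  · split_ifs <;> first | assumption | norm_num

theorem card_unblocked_le (D : ℕ) (hD : ∀ u, (univ.filter fun v => G.Adj u v).card ≤ D)
    (x : V → Bool) : (unblocked G x).card ≤ numParticles x * D := by
  have : unblocked G x ⊆ (univ.filter fun u => x u = true).biUnion
      fun u => univ.filter fun v => G.Adj u v := by
    intro v hv
    simp only [unblocked, Finset.mem_filter, Finset.mem_univ, true_and] at hv
    obtain ⟨u, h1, h2⟩ := hv
    simp only [Finset.mem_biUnion, Finset.mem_filter, Finset.mem_univ, true_and]
    exact ⟨u, h2, h1⟩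
  exact (Finset.card_le_card this).trans (Finset.card_biUnion_le_card_mul _ _ _ fun u _ => hD u)

theorem traceKernel_eq (k : ℕ) (x y : OmegaK G k) :
    traceKernel G p k x y = ∑' t, firstVisit (kcipKernel G p) (OmegaK G k) t x y := rfl

theorem traceKernel_nonneg (hp0 : 0 ≤ p) (hp1 : p ≤ 1) (k : ℕ) (x y : OmegaK G k) :
    0 ≤ traceKernel G p k x y :=
  tsum_nonneg fun _ => firstVisit_nonneg _ (kcipKernel_nonneg G p hp0 hp1) _ _ _ _

theorem traceKernel_row (hp0 : 0 ≤ p) (hp1 : p ≤ 1) (k : ℕ) [Fintype (OmegaK G k)]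
    (x : OmegaK G k) : ∑ y, traceKernel G p k x y ≤ 1 := by
  convert sum_tsum_firstVisit_le_one _ (kcipKernel_nonneg G p hp0 hp1) (kcipKernel_row G p)
    (OmegaK G k) x.1
  rfl

theorem traceKernel_symm (hp0 : 0 < p) (hp1 : p < 1) (k : ℕ) (x y : OmegaK G k) :
    traceKernel G p k x y = traceKernel G p k y x := by
  rw [traceKernel_eq, traceKernel_eq]
  refine tsum_congr fun t => ?_
  have h := firstVisit_detailed_balance (kcipKernel G p) (bernoulliWeight p)
    (kcipKernel_reversible G p) (OmegaK G k) t x y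
  have hxy : bernoulliWeight p x.1 = bernoulliWeight p y.1 := by
    rw [bernoulliWeight_eq, bernoulliWeight_eq, x.2.1, y.2.1]
  have hpos : 0 < bernoulliWeight p y.1 := by
    refine Finset.prod_pos fun v _ => ?_
    have : 0 < 1 - p := by linarith
    split_ifs <;> assumption
  rw [hxy] at h
  exact mul_left_cancel₀ hpos.ne' h

theorem traceKernel_self_ge [Nonempty V] (hp0 : 0 ≤ p) (hp1 : p ≤ 1) (k D : ℕ)
    (hD : ∀ u, (univ.filter fun v => G.Adj u v).card ≤ D) (x : OmegaK G k) :
    1 - (k * D : ℝ) / Fintype.card V ≤ traceKernel G p k x x := by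
  have h0 := kcipKernel_nonneg G p hp0 hp1
  have h1 := one_sub_kcipKernel_self_le G p hp0 hp1 x.1
  have h2 : ((unblocked G x.1).card : ℝ) ≤ k * D := by
    have := card_unblocked_le G D hD x.1
    rw [x.2.1] at this
    exact_mod_cast this
  have hs := summable_firstVisit _ h0 (kcipKernel_row G p) (OmegaK G k) x.1 x.1 x.2
  have h3 := hs.le_tsum 0 fun t _ => firstVisit_nonneg _ h0 _ _ _ _
  rw [firstVisit_zero] at h3
  have h4 : ((unblocked G x.1).card : ℝ) / Fintype.card V ≤ (k * D : ℝ) / Fintype.card V := by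
    gcongr
  rw [traceKernel_eq]
  linarith

/-- Moving one particle from `u` to a neighbouring vertex `v` has probability of order `n⁻²`. -/
theorem traceKernel_move_ge [Nonempty V] (hp0 : 0 < p) (hp1 : p < 1) (k D : ℕ) (hDpos : 0 < D)
    (hD : ∀ u, (univ.filter fun v => G.Adj u v).card ≤ D) (x y : OmegaK G k) (u v : V)
    (huv : G.Adj u v) (hxu : x.1 u = true) (hxv : x.1 v = false)
    (hy : y.1 = Function.update (Function.update x.1 v true) u false) :
    p * (1 - p) / ((k + 1) * D * Fintype.card V) ≤ traceKernel G p k x y := by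
  have hc : (0 : ℝ) < Fintype.card V := by exact_mod_cast Fintype.card_pos
  have hp' : 0 < 1 - p := by linarith
  have h0 := kcipKernel_nonneg G p hp0.le hp1.le
  set w : V → Bool := Function.update x.1 v true with hw
  have hwn : numParticles w = k + 1 := by
    have h1 : (univ.filter fun a => w a = true) =
        insert v (univ.filter fun a => x.1 a = true) := by
      ext a
      by_cases ha : a = v
      · subst ha; simp [hw]
      · simp [hw, ha]
    unfold numParticles
    rw [h1, Finset.card_insert_of_notMem (by simp [hxv])]
    have := x.2.1
    unfold numParticles at this
    rw [this]
  have hwu : w u = true := by rw [hw, Function.update_of_ne huv.ne]; exact hxu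
  have hwΩ : w ∉ OmegaK G k := fun h => by
    have := h.1
    omega
  have hxw : (Fintype.card V : ℝ)⁻¹ * p ≤ kcipKernel G p x.1 w := by
    have := kcipKernel_ge_of_unblocked G p hp0.le hp1.le x.1 w v ⟨u, huv, hxu⟩
      (fun a ha => Function.update_of_ne ha _ _)
    rwa [if_pos (by simp [hw])] at this
  have hwy : (Fintype.card V : ℝ)⁻¹ * (1 - p) ≤ kcipKernel G p w y.1 := by
    have := kcipKernel_ge_of_unblocked G p hp0.le hp1.le w y.1 u ⟨v, huv.symm, by simp [hw]⟩
      (fun a ha => by rw [hy, Function.update_of_ne ha])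
    rwa [if_neg (by simp [hy])] at this
  have hδ : 1 - kcipKernel G p w w ≤ (k + 1) * D / Fintype.card V := by
    refine (one_sub_kcipKernel_self_le G p hp0.le hp1.le w).trans ?_
    have := card_unblocked_le G D hD w
    rw [hwn] at this
    have h2 : ((unblocked G w).card : ℝ) ≤ (k + 1) * D := by exact_mod_cast this
    gcongr
  have hpos : 0 < kcipKernel G p w y.1 := lt_of_lt_of_le (by positivity) hwy
  have key := tsum_firstVisit_ge _ h0 (kcipKernel_row G p) (OmegaK G k) x.1 w y.1 hwΩ y.2 hpos _ hδ
  rw [traceKernel_eq]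
  refine le_trans ?_ key
  have hD' : (0 : ℝ) < D := by exact_mod_cast hDpos
  rw [le_div_iff₀ (by positivity)]
  calc p * (1 - p) / ((k + 1) * D * Fintype.card V) * ((k + 1) * D / Fintype.card V)
      = (Fintype.card V : ℝ)⁻¹ * p * ((Fintype.card V : ℝ)⁻¹ * (1 - p)) := by
        field_simp
    _ ≤ _ := mul_le_mul hxw hwy (by positivity) (h0 _ _)

end Kernel

section Geometry

variable {N k d : ℕ}

theorem torusGraph_adj (u v : Fin d → ZMod N) : (torusGraph N d).Adj u v ↔
    u ≠ v ∧ ((∃ j, v = u + Pi.single j 1) ∨ ∃ j, u = v + Pi.single j 1) := by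
  have h : ∀ j : Fin d, (fun l => if l = j then (1 : ZMod N) else 0) = Pi.single j 1 := by
    intro j
    funext l
    rw [Pi.single_apply]
  simp only [torusGraph, SimpleGraph.fromRel_adj, h]

/-- Labelled particle configurations with no two particles equal or adjacent. -/
def Admissible (a : Fin k → Fin d → ZMod N) : Prop :=
  ∀ i i', i ≠ i' → a i ≠ a i' ∧ ¬(torusGraph N d).Adj (a i) (a i')

/-- The `j`-th coordinates of distinct particles are pairwise at cyclic distance at least `2`. -/
def Separated (j : Fin d) (a : Fin k → Fin d → ZMod N) : Prop :=
  ∀ i i', i ≠ i' → a i j - a i' j ≠ 0 ∧ a i j - a i' j ≠ 1 ∧ a i j - a i' j ≠ -1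

theorem Separated.admissible {j : Fin d} {a : Fin k → Fin d → ZMod N} (h : Separated j a) :
    Admissible a := by
  intro i i' hi
  obtain ⟨h0, h1, h2⟩ := h i i' hi
  refine ⟨fun he => h0 (by rw [he, sub_self]), fun hadj => ?_⟩
  rw [torusGraph_adj] at hadj
  rcases hadj.2 with ⟨l, hl⟩ | ⟨l, hl⟩
  · rw [hl, Pi.add_apply, Pi.single_apply] at h0 h2
    split_ifs at h0 h2 <;> simp_all
  · rw [hl, Pi.add_apply, Pi.single_apply] at h0 h1
    split_ifs at h0 h1 <;> simp_all

theorem Separated.congr {j : Fin d} {a b : Fin k → Fin d → ZMod N} (h : Separated j a)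
    (hb : ∀ i, b i j = a i j) : Separated j b := by
  intro i i' hi
  rw [hb, hb]
  exact h i i' hi

theorem eq_off_of_adj {u v : Fin d → ZMod N} (h : (torusGraph N d).Adj u v) {j : Fin d}
    (hj : u j ≠ v j) : ∀ l, l ≠ j → u l = v l := by
  intro l hl
  rw [torusGraph_adj] at h
  rcases h.2 with ⟨m, hm⟩ | ⟨m, hm⟩
  · have : m = j := by
      by_contra hne
      apply hj
      rw [hm, Pi.add_apply, Pi.single_apply, if_neg (Ne.symm hne), add_zero]
    rw [hm, Pi.add_apply, Pi.single_apply, if_neg (this ▸ hl), add_zero]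
  · have : m = j := by
      by_contra hne
      apply hj
      rw [hm, Pi.add_apply, Pi.single_apply, if_neg (Ne.symm hne), add_zero]
    rw [hm, Pi.add_apply, Pi.single_apply, if_neg (this ▸ hl), add_zero]

theorem sub_of_adj {u v : Fin d → ZMod N} (h : (torusGraph N d).Adj u v) (j : Fin d) :
    u j - v j = 0 ∨ u j - v j = 1 ∨ u j - v j = -1 := by
  rw [torusGraph_adj] at h
  rcases h.2 with ⟨m, hm⟩ | ⟨m, hm⟩
  · rw [hm, Pi.add_apply, Pi.single_apply]
    split_ifs <;> simp
  · rw [hm, Pi.add_apply, Pi.single_apply]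
    split_ifs <;> simp

/-- All coordinates of `b` differ from those of `a` by at most `r`. -/
def Near (r : ℕ) (a b : Fin k → Fin d → ZMod N) : Prop :=
  ∀ i l, ∃ z : ℤ, z.natAbs ≤ r ∧ b i l = a i l + z

theorem Near.refl (r : ℕ) (a : Fin k → Fin d → ZMod N) : Near r a a :=
  fun _ _ => ⟨0, by simp, by simp⟩

theorem Near.symm {r : ℕ} {a b : Fin k → Fin d → ZMod N} (h : Near r a b) : Near r b a := by
  intro i l
  obtain ⟨z, hz, h⟩ := h i l
  exact ⟨-z, by simpa using hz, by rw [h]; push_cast; ring⟩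

theorem Near.trans {r s : ℕ} {a b c : Fin k → Fin d → ZMod N} (h : Near r a b)
    (h' : Near s b c) : Near (r + s) a c := by
  intro i l
  obtain ⟨z, hz, h⟩ := h i l
  obtain ⟨z', hz', h'⟩ := h' i l
  exact ⟨z + z', by omega, by rw [h', h]; push_cast; ring⟩

theorem Near.mono {r s : ℕ} (hrs : r ≤ s) {a b : Fin k → Fin d → ZMod N} (h : Near r a b) :
    Near s a b := by
  intro i l
  obtain ⟨z, hz, h⟩ := h i l
  exact ⟨z, hz.trans hrs, h⟩

/-- One particle moves to a neighbouring vertex, both configurations being admissible. -/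
def Step (a b : Fin k → Fin d → ZMod N) : Prop :=
  Admissible a ∧ Admissible b ∧
    ∃ i, (torusGraph N d).Adj (a i) (b i) ∧ ∀ i', i' ≠ i → b i' = a i'

theorem Step.near {a b : Fin k → Fin d → ZMod N} (h : Step a b) : Near 1 a b := by
  obtain ⟨-, -, i, hadj, hoff⟩ := h
  intro i' l
  by_cases hi : i' = i
  · subst hi
    rcases sub_of_adj hadj l with h | h | h
    · exact ⟨0, by simp, by rw [sub_eq_zero.mp h]; simp⟩
    · exact ⟨-1, by simp, by rw [sub_eq_iff_eq_add.mp h]; push_cast; ring⟩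
    · exact ⟨1, by simp, by rw [sub_eq_iff_eq_add.mp h]; push_cast; ring⟩
  · exact ⟨0, by simp, by rw [hoff i' hi]; simp⟩

theorem Step.symm {a b : Fin k → Fin d → ZMod N} (h : Step a b) : Step b a := by
  obtain ⟨ha, hb, i, hadj, hoff⟩ := h
  exact ⟨hb, ha, i, hadj.symm, fun i' hi => (hoff i' hi).symm⟩

/-- `b` can be reached from `a` in at most `m` steps. -/
def Reach : ℕ → (Fin k → Fin d → ZMod N) → (Fin k → Fin d → ZMod N) → Prop
  | 0, a, b => a = b
  | m + 1, a, b => ∃ c, Reach m a c ∧ (c = b ∨ Step c b)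

theorem Reach.refl (m : ℕ) (a : Fin k → Fin d → ZMod N) : Reach m a a := by
  induction m with
  | zero => rfl
  | succ m ih => exact ⟨a, ih, Or.inl rfl⟩

theorem Reach.trans {m m' : ℕ} {a b c : Fin k → Fin d → ZMod N} (h : Reach m a b)
    (h' : Reach m' b c) : Reach (m + m') a c := by
  induction m' generalizing c with
  | zero => exact h' ▸ h
  | succ m' ih =>
    obtain ⟨e, he, hs⟩ := h'
    exact ⟨e, ih he, hs⟩

theorem Reach.mono {m m' : ℕ} (hm : m ≤ m') {a b : Fin k → Fin d → ZMod N} (h : Reach m a b) :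
    Reach m' a b := by
  obtain ⟨e, rfl⟩ := Nat.exists_eq_add_of_le hm
  exact h.trans (Reach.refl e b)

theorem Reach.near {m : ℕ} {a b : Fin k → Fin d → ZMod N} (h : Reach m a b) : Near m a b := by
  induction m generalizing b with
  | zero => exact h ▸ Near.refl 0 a
  | succ m ih =>
    obtain ⟨c, hc, rfl | hs⟩ := h
    · exact (ih hc).mono (Nat.le_succ m)
    · exact (ih hc).trans hs.near

/-- The displacement by `z` of the `l`-th coordinate of the `i`-th particle. -/
def bump (i : Fin k) (l : Fin d) (z : ZMod N) : Fin k → Fin d → ZMod N :=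
  Pi.single i (Pi.single l z)

theorem bump_apply (i i' : Fin k) (l l' : Fin d) (z : ZMod N) :
    bump i l z i' l' = if i' = i ∧ l' = l then z else 0 := by
  unfold bump
  by_cases hi : i' = i
  · subst hi
    rw [Pi.single_eq_same, Pi.single_apply]
    simp
  · rw [Pi.single_eq_of_ne hi]
    simp [hi]

theorem bump_zero (i : Fin k) (l : Fin d) : bump i l (0 : ZMod N) = 0 := by
  simp [bump]

theorem bump_add (i : Fin k) (l : Fin d) (z z' : ZMod N) :
    bump i l (z + z') = bump i l z + bump i l z' := by
  simp [bump, Pi.single_add]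

theorem bump_natCast (i : Fin k) (l : Fin d) (m : ℕ) :
    bump i l (m : ZMod N) = m • bump i l (1 : ZMod N) := by
  induction m with
  | zero => simp [bump_zero]
  | succ m ih => rw [succ_nsmul, ← ih, ← bump_add]; push_cast; rfl

theorem sum_bump (w : Fin k → Fin d → ZMod N) :
    ∑ q : Fin k × Fin d, bump q.1 q.2 (w q.1 q.2) = w := by
  funext i l
  rw [Finset.sum_apply, Finset.sum_apply, Finset.sum_eq_single (i, l)]
  · simp [bump_apply]
  · rintro ⟨i', l'⟩ - hne
    rw [bump_apply, if_neg]
    rintro ⟨rfl, rfl⟩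
    exact hne rfl
  · simp

theorem near_bump (x : Fin k → Fin d → ZMod N) (i : Fin k) (l : Fin d) :
    Near 1 x (x + bump i l 1) := by
  intro i' l'
  rw [Pi.add_apply, Pi.add_apply, bump_apply]
  split_ifs
  · exact ⟨1, by simp, by simp⟩
  · exact ⟨0, by simp, by simp⟩

theorem step_bump (hN : 2 ≤ N) (a : Fin k → Fin d → ZMod N) (i : Fin k) (l : Fin d)
    (ε : ZMod N) (hε : ε = 1 ∨ ε = -1) (ha : Admissible a) (hb : Admissible (a + bump i l ε)) :
    Step a (a + bump i l ε) := by
  have : Fact (1 < N) := ⟨hN⟩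
  refine ⟨ha, hb, i, ?_, fun i' hi => ?_⟩
  · have hbi : (a + bump i l ε) i = a i + Pi.single l ε := by simp [bump]
    rw [torusGraph_adj, hbi]
    constructor
    · intro h
      have := congrFun h l
      rw [Pi.add_apply, Pi.single_eq_same, left_eq_add] at this
      rcases hε with rfl | rfl <;> simp at this
    · rcases hε with rfl | rfl
      · exact Or.inl ⟨l, rfl⟩
      · refine Or.inr ⟨l, ?_⟩
        rw [add_assoc, ← Pi.single_add]
        simp
  · simp [bump, hi]

theorem reach_line (hN : 2 ≤ N) (a : Fin k → Fin d → ZMod N) (i : Fin k) (l : Fin d)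
    (ε : ZMod N) (hε : ε = 1 ∨ ε = -1) (m : ℕ)
    (h : ∀ s : ℕ, s ≤ m → Admissible (a + bump i l ((s : ZMod N) * ε))) :
    Reach m a (a + bump i l ((m : ZMod N) * ε)) := by
  induction m with
  | zero => simp [bump_zero, Reach]
  | succ m ih =>
    refine ⟨_, ih fun s hs => h s (hs.trans (Nat.le_succ m)), Or.inr ?_⟩
    have e : a + bump i l (((m + 1 : ℕ) : ZMod N) * ε) =
        a + bump i l ((m : ZMod N) * ε) + bump i l ε := by
      rw [add_assoc, ← bump_add]
      congr 2
      push_cast; ring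
    rw [e]
    exact step_bump hN _ i l ε hε (h m (Nat.le_succ m)) (e ▸ h (m + 1) le_rfl)

theorem Separated.reach_bump (hN : 2 ≤ N) {j : Fin d} {a : Fin k → Fin d → ZMod N}
    (h : Separated j a) (i : Fin k) (l : Fin d) (hl : l ≠ j) (z : ℤ) (r : ℕ)
    (hz : z.natAbs ≤ r) : Reach r a (a + bump i l (z : ZMod N)) := by
  have hadm : ∀ y : ZMod N, Admissible (a + bump i l y) := fun y =>
    (h.congr fun i' => by simp [bump_apply, Ne.symm hl]).admissible
  refine Reach.mono hz ?_
  rcases Int.natAbs_eq z with hz' | hz'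
  · have := reach_line hN a i l 1 (Or.inl rfl) z.natAbs fun s _ => hadm _
    have hc := congrArg (Int.cast : ℤ → ZMod N) hz'
    rw [Int.cast_natCast] at hc
    rwa [hc, ← mul_one (z.natAbs : ZMod N)]
  · have := reach_line hN a i l (-1) (Or.inr rfl) z.natAbs fun s _ => hadm _
    have hc := congrArg (Int.cast : ℤ → ZMod N) hz'
    rw [Int.cast_neg, Int.cast_natCast] at hc
    rwa [hc, ← mul_neg_one]

/-- As long as the `j`-th coordinates stay fixed and separated, the other ones move freely. -/
theorem Separated.reach (hN : 2 ≤ N) {j : Fin d} {a b : Fin k → Fin d → ZMod N}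
    (h : Separated j a) (hb : ∀ i, b i j = a i j) {r : ℕ} (hr : Near r a b) :
    Reach (k * d * r) a b := by
  have key : ∀ T : Finset (Fin k × Fin d),
      Reach (T.card * r) a (fun i l => if (i, l) ∈ T then b i l else a i l) := by
    intro T
    induction T using Finset.induction_on with
    | empty => simp [Reach]
    | insert q T hq ih =>
      obtain ⟨i, l⟩ := q
      rw [Finset.card_insert_of_notMem hq, add_mul, one_mul]
      refine ih.trans ?_
      obtain ⟨z, hz, hbz⟩ := hr i l
      have e : (fun i' l' => if (i', l') ∈ insert (i, l) T then b i' l' else a i' l') =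
          (fun i' l' => if (i', l') ∈ T then b i' l' else a i' l') + bump i l (z : ZMod N) := by
        funext i' l'
        rw [Pi.add_apply, Pi.add_apply, bump_apply]
        by_cases hil : i' = i ∧ l' = l
        · obtain ⟨rfl, rfl⟩ := hil
          simp [hq, hbz]
        · have : (i', l') ≠ (i, l) := fun h => hil (by simpa using h)
          simp [hil, this]
      by_cases hl : l = j
      · have hz0 : (z : ZMod N) = 0 := by
          subst hl
          rw [hb] at hbz
          simpa using hbz
        rw [e, hz0, bump_zero, add_zero]
        exact Reach.refl _ _
      · rw [e]
        refine Separated.reach_bump hN (h.congr fun i' => ?_) i l hl z r hz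
        split_ifs
        · exact hb i'
        · rfl
  have := key Finset.univ
  simpa using this

/-- Displacement of the `j`-th coordinates by the natural numbers `s`. -/
def shift (j : Fin d) (s : Fin k → ℕ) (x : Fin k → Fin d → ZMod N) : Fin k → Fin d → ZMod N :=
  fun i l => x i l + if l = j then (s i : ZMod N) else 0

theorem natCast_zmod_ne_zero {δ : ℕ} (h1 : 1 ≤ δ) (h2 : δ < N) : (δ : ZMod N) ≠ 0 := by
  rw [Ne, ZMod.natCast_eq_zero_iff]
  exact fun h => absurd (Nat.le_of_dvd h1 h) (by omega)

theorem natCast_zmod_separated {δ : ℕ} (h1 : 2 ≤ δ) (h2 : δ + 2 ≤ N) :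
    (δ : ZMod N) ≠ 0 ∧ (δ : ZMod N) ≠ 1 ∧ (δ : ZMod N) ≠ -1 := by
  refine ⟨natCast_zmod_ne_zero (by omega) (by omega), fun h => ?_, fun h => ?_⟩
  · apply natCast_zmod_ne_zero (N := N) (δ := δ - 1) (by omega) (by omega)
    rw [Nat.cast_sub (by omega), h]; simp
  · apply natCast_zmod_ne_zero (N := N) (δ := δ + 1) (by omega) (by omega)
    push_cast
    rw [h]; simp

theorem exists_cut [NeZero N] (hN : k * (3 * k + 1) < N) (x : Fin k → ZMod N) :
    ∃ h : ZMod N, ∀ i, (x i - h).val + (3 * k + 2) ≤ N := by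
  let bad : Finset (ZMod N) := (Finset.univ ×ˢ Finset.range (3 * k + 1)).image
    fun q : Fin k × ℕ => x q.1 + (q.2 + 1 : ℕ)
  have hbad : bad.card < (Finset.univ : Finset (ZMod N)).card := by
    refine Finset.card_image_le.trans_lt ?_
    rw [Finset.card_product, Finset.card_univ, Finset.card_univ, ZMod.card, Fintype.card_fin,
      Finset.card_range]
    exact hN
  obtain ⟨h, -, hh⟩ := Finset.exists_mem_notMem_of_card_lt_card hbad
  refine ⟨h, fun i => ?_⟩
  by_contra hc
  apply hh
  have hv := ZMod.val_lt (x i - h)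
  refine Finset.mem_image.mpr ⟨(i, N - (x i - h).val - 1), ?_, ?_⟩
  · simp only [Finset.mem_product, Finset.mem_univ, true_and, Finset.mem_range]
    omega
  · dsimp only
    rw [Nat.sub_add_cancel (by omega), Nat.cast_sub hv.le, ZMod.natCast_zmod_val]
    simp

theorem admissible_shift {j : Fin d} {x : Fin k → Fin d → ZMod N} (hx : Admissible x)
    (h : ZMod N) (a : Fin k → ℕ) (hxa : ∀ i, x i j = h + a i) (κ : Fin k → ℕ)
    (hκinj : Function.Injective κ) (hκ : ∀ i i', κ i < κ i' → a i ≤ a i') (s : Fin k → ℕ)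
    (hs : ∀ i, a i + s i + 2 ≤ N) (hss : ∀ i i', κ i < κ i' → s i = 0 ∨ s i + 3 ≤ s i') :
    Admissible (shift j s x) := by
  have key : ∀ i i', κ i < κ i' → shift j s x i' ≠ shift j s x i ∧
      ¬(torusGraph N d).Adj (shift j s x i') (shift j s x i) := by
    intro i i' hi
    have hne : i ≠ i' := fun he => by rw [he] at hi; exact lt_irrefl _ hi
    have ha := hκ i i' hi
    have hN := hs i'
    rcases Nat.eq_zero_or_pos (s i') with h0 | h0
    · have h1 : s i = 0 := by have := hss i i' hi; omega
      have e : ∀ m, s m = 0 → shift j s x m = x m := fun m hm => by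
        funext l
        simp [shift, hm]
      rw [e i h1, e i' h0]
      exact hx i' i hne.symm
    · have hlt : a i + s i + 1 ≤ a i' + s i' := by have := hss i i' hi; omega
      have hdiff : shift j s x i' j - shift j s x i j =
          ((a i' + s i' - (a i + s i) : ℕ) : ZMod N) := by
        rw [Nat.cast_sub (by omega)]
        simp only [shift, hxa, if_true]
        push_cast; ring
      have hd0 : shift j s x i' j - shift j s x i j ≠ 0 := by
        rw [hdiff]
        exact natCast_zmod_ne_zero (by omega) (by omega)
      refine ⟨fun he => hd0 (by rw [he, sub_self]), fun hadj => ?_⟩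
      by_cases h2 : a i + s i + 2 ≤ a i' + s i'
      · have := natCast_zmod_separated (N := N) (δ := a i' + s i' - (a i + s i))
          (by omega) (by omega)
        rw [← hdiff] at this
        rcases sub_of_adj hadj j with h' | h' | h'
        · exact this.1 h'
        · exact this.2.1 h'
        · exact this.2.2 h'
      · have hai : a i = a i' := by have := hss i i' hi; omega
        have hoff := eq_off_of_adj hadj (j := j) (fun h' => hd0 (by rw [h', sub_self]))
        apply (hx i i' hne).1
        funext l
        by_cases hl : l = j
        · rw [hl, hxa, hxa, hai]
        · have := hoff l hl
          simp only [shift, hl, if_false, add_zero] at this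
          exact this.symm
  intro i i' hi
  rcases lt_or_gt_of_ne (hκinj.ne hi) with h' | h'
  · obtain ⟨h1, h2⟩ := key i i' h'
    exact ⟨h1.symm, fun h => h2 h.symm⟩
  · exact key i' i h'

/-- Spreading out the particles along a coordinate by sliding each one by a bounded amount. -/
theorem exists_shift [NeZero N] (hN : k * (3 * k + 1) < N) (hN2 : 2 ≤ N)
    (x : Fin k → Fin d → ZMod N) (j : Fin d) :
    ∃ y, Separated j y ∧ Near (3 * k) x y ∧ (∀ i l, l ≠ j → y i l = x i l) ∧
      (Admissible x → Reach (k * (3 * k)) x y) := by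
  obtain ⟨h, hh⟩ := exists_cut hN fun i => x i j
  set a : Fin k → ℕ := fun i => (x i j - h).val with ha
  have hxa : ∀ i, x i j = h + a i := fun i => by simp [ha]
  set κ : Fin k → ℕ := fun i => a i * k + i with hκdef
  have hκinj : Function.Injective κ := by
    intro i i' he
    have h1 : κ i % k = κ i' % k := by rw [he]
    simp only [hκdef, Nat.mul_add_mod_self_right, Nat.mod_eq_of_lt i.2, Nat.mod_eq_of_lt i'.2] at h1
    exact Fin.ext h1
  have hκ : ∀ i i', κ i < κ i' → a i ≤ a i' := by
    intro i i' hi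
    by_contra hc
    have h1 : (a i' + 1) * k ≤ a i * k := Nat.mul_le_mul_right k (by omega)
    have h2 := i'.2
    simp only [hκdef] at hi
    rw [add_mul] at h1
    omega
  set rank : Fin k → ℕ := fun i => (univ.filter fun i' => κ i' < κ i).card with hrank
  have hrank_lt : ∀ i, rank i < k := by
    intro i
    have : (univ.filter fun i' => κ i' < κ i) ⊂ univ :=
      Finset.filter_ssubset.mpr ⟨i, Finset.mem_univ i, lt_irrefl _⟩
    simpa using Finset.card_lt_card this
  have hrank_mono : ∀ i i', κ i < κ i' → rank i < rank i' := by
    intro i i' hi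
    refine Finset.card_lt_card (Finset.ssubset_iff_of_subset ?_ |>.mpr ⟨i, ?_, ?_⟩)
    · intro m hm
      simp only [Finset.mem_filter, Finset.mem_univ, true_and] at hm ⊢
      exact hm.trans hi
    · simpa using hi
    · simp
  have hrank_iff : ∀ i i', rank i < rank i' → κ i < κ i' := by
    intro i i' hr
    by_contra hc
    rcases (not_lt.mp hc).lt_or_eq with h' | h'
    · have := hrank_mono _ _ h'; omega
    · rw [hκinj h'] at hr; exact lt_irrefl _ hr
  refine ⟨shift j (fun i => 3 * rank i) x, ?_, ?_, ?_, ?_⟩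
  · have key : ∀ i i', κ i < κ i' →
        ∃ δ : ℕ, 2 ≤ δ ∧ δ + 2 ≤ N ∧ shift j (fun i => 3 * rank i) x i' j
          - shift j (fun i => 3 * rank i) x i j = δ := by
      intro i i' hi
      have h1 := hκ i i' hi
      have h2 := hrank_mono i i' hi
      have h3 := hrank_lt i'
      have h4 : a i' + (3 * k + 2) ≤ N := hh i'
      refine ⟨a i' + 3 * rank i' - (a i + 3 * rank i), by omega, by omega, ?_⟩
      rw [Nat.cast_sub (by omega)]
      simp only [shift, hxa, if_true]
      push_cast; ring
    intro i i' hi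
    rcases lt_or_gt_of_ne (hκinj.ne hi) with h' | h'
    · obtain ⟨δ, h1, h2, h3⟩ := key i i' h'
      obtain ⟨h4, h5, h6⟩ := natCast_zmod_separated h1 h2
      rw [← h3] at h4 h5 h6
      rw [← neg_sub]
      exact ⟨neg_ne_zero.mpr h4, fun h => h6 (by rw [← h, neg_neg]), fun h => h5 (neg_injective h)⟩
    · obtain ⟨δ, h1, h2, h3⟩ := key i' i h'
      rw [h3]
      exact natCast_zmod_separated h1 h2
  · intro i l
    by_cases hl : l = j
    · exact ⟨(3 * rank i : ℕ), by have := hrank_lt i; rw [Int.natAbs_natCast]; omega,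
        by simp [shift, hl]⟩
    · exact ⟨0, by simp, by simp [shift, hl]⟩
  · intro i l hl
    simp [shift, hl]
  · intro hx
    have hadm := admissible_shift hx h a hxa κ hκinj hκ
    let stage : ℕ → Fin k → ℕ := fun q i => if k ≤ rank i + q then 3 * rank i else 0
    have hstage : ∀ q, q ≤ k → Reach (q * (3 * k)) x (shift j (stage q) x) := by
      intro q
      induction q with
      | zero =>
        intro _
        have : shift j (stage 0) x = x := by
          funext i l
          have := hrank_lt i
          simp [shift, stage, this]
        rw [this]
        exact Reach.refl _ _
      | succ q ih =>
        intro hq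
        rw [add_mul, one_mul]
        refine (ih (by omega)).trans ?_
        by_cases hex : ∃ i, rank i + q + 1 = k
        · obtain ⟨i, hi⟩ := hex
          have huniq : ∀ i', i' ≠ i → rank i' ≠ rank i := by
            intro i' hne
            rcases lt_or_gt_of_ne (hκinj.ne hne) with h' | h'
            · exact (hrank_mono _ _ h').ne
            · exact (hrank_mono _ _ h').ne'
          have hbump : ∀ s : ℕ, shift j (stage q) x + bump i j ((s : ZMod N) * 1) =
              shift j (fun i' => if i' = i then s else stage q i') x := by
            intro s
            funext i' l
            rw [Pi.add_apply, Pi.add_apply, bump_apply]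
            by_cases h1 : i' = i
            · subst h1
              have : ¬ k ≤ rank i' + q := by omega
              by_cases h2 : l = j <;> simp [shift, stage, this, h2]
            · simp [shift, h1]
          have hfin : shift j (stage (q + 1)) x =
              shift j (stage q) x + bump i j (((3 * rank i : ℕ) : ZMod N) * 1) := by
            rw [hbump]
            congr 1
            funext i'
            by_cases h1 : i' = i
            · subst h1
              simp only [stage, if_true]
              rw [if_pos (by omega)]
            · have := huniq i' h1
              simp only [stage, h1, if_false]
              by_cases h2 : k ≤ rank i' + q
              · rw [if_pos h2, if_pos (by omega)]
              · rw [if_neg h2, if_neg (by omega)]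
          rw [hfin]
          refine Reach.mono (m := 3 * rank i) (by have := hrank_lt i; omega) ?_
          refine reach_line hN2 _ i j 1 (Or.inl rfl) _ fun s hs => ?_
          rw [hbump]
          refine hadm _ (fun i' => ?_) fun i₁ i₂ h12 => ?_
          · have h4 : a i' + (3 * k + 2) ≤ N := hh i'
            have h5 := hrank_lt i'
            have h6 := hrank_lt i
            dsimp only [stage]
            split_ifs <;> omega
          · have h5 := hrank_mono i₁ i₂ h12
            dsimp only [stage]
            by_cases h1 : i₁ = i
            · have h2 : i₂ ≠ i := fun h2 => by rw [h1, h2] at h12; exact lt_irrefl _ h12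
              subst h1
              rw [if_pos rfl, if_neg h2, if_pos (by omega)]
              omega
            · rw [if_neg h1]
              by_cases h2 : i₂ = i
              · subst h2
                rw [if_neg (by omega)]
                exact Or.inl rfl
              · rw [if_neg h2]
                split_ifs <;> omega
        · have : shift j (stage (q + 1)) x = shift j (stage q) x := by
            congr 1
            funext i'
            have : rank i' + q + 1 ≠ k := fun h' => hex ⟨i', h'⟩
            simp only [stage]
            by_cases h2 : k ≤ rank i' + q
            · rw [if_pos h2, if_pos (by omega)]
            · rw [if_neg h2, if_neg (by omega)]
          rw [this]
          exact Reach.refl _ _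
    have := hstage k le_rfl
    have e : stage k = fun i => 3 * rank i := by
      funext i
      simp [stage]
    rwa [e] at this

/-- Two nearby configurations separated in the direction `j` are connected by few steps. -/
theorem reach_of_separated [NeZero N] (hN : k * (3 * k + 1) < N) (hN2 : 2 ≤ N)
    {j j' : Fin d} (hj : j ≠ j') {a b : Fin k → Fin d → ZMod N} (ha : Separated j a)
    (hb : Separated j b) {r : ℕ} (hr : Near r a b) :
    Reach (3 * (k * d * (r + 3 * k))) a b := by
  obtain ⟨σ, hσ, hσn, hσoff, -⟩ := exists_shift hN hN2 a j'
  let c₁ : Fin k → Fin d → ZMod N :=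
    fun i l => if l = j' then σ i l else if l = j then a i l else b i l
  let c₂ : Fin k → Fin d → ZMod N := fun i l => if l = j' then σ i l else b i l
  have hr' : Near (r + 3 * k) a b := hr.mono (by omega)
  have hσ' : Near (r + 3 * k) a σ := hσn.mono (by omega)
  have hσb : Near (r + 3 * k) σ b := by
    have := hσn.symm.trans hr
    exact this.mono (by omega)
  have h1 : Reach (k * d * (r + 3 * k)) a c₁ := by
    refine ha.reach hN2 (fun i => by simp [c₁, hj]) fun i l => ?_
    by_cases hl : l = j'
    · simpa [c₁, hl] using hσ' i l
    · by_cases hl' : l = j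
      · exact ⟨0, by simp, by simp [c₁, hl', hj]⟩
      · simpa [c₁, hl, hl'] using hr' i l
  have h2 : Reach (k * d * (r + 3 * k)) c₁ c₂ := by
    refine (hσ.congr (b := c₁) (fun i => by simp [c₁])).reach hN2 (fun i => by simp [c₁, c₂])
      fun i l => ?_
    by_cases hl : l = j'
    · exact ⟨0, by simp, by simp [c₁, c₂, hl]⟩
    · by_cases hl' : l = j
      · simpa [c₁, c₂, hl', hj] using hr' i j
      · exact ⟨0, by simp, by simp [c₁, c₂, hl, hl']⟩
  have h3 : Reach (k * d * (r + 3 * k)) c₂ b := by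
    refine (hb.congr (b := c₂) (fun i => by simp [c₂, hj])).reach hN2
      (fun i => by simp [c₂, hj]) fun i l => ?_
    by_cases hl : l = j'
    · simpa [c₂, hl] using hσb i l
    · exact ⟨0, by simp, by simp [c₂, hl]⟩
  exact ((h1.trans h2).trans h3).mono (by omega)

end Geometry

section Energy

variable {N k d : ℕ} [NeZero N]

/-- The displacements all of whose coordinates have cyclic absolute value at most `r`. -/
def displacements (N k d r : ℕ) [NeZero N] : Finset (Fin k → Fin d → ZMod N) :=
  univ.filter fun θ => Near r 0 θ

theorem card_displacements_le (r : ℕ) :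
    (displacements N k d r).card ≤ (2 * r + 1) ^ (k * d) := by
  let Z : Finset (Fin k → Fin d → ℤ) :=
    Fintype.piFinset fun _ => Fintype.piFinset fun _ => Finset.Icc (-(r : ℤ)) r
  have hsub : displacements N k d r ⊆ Z.image fun z i l => (z i l : ZMod N) := by
    intro θ hθ
    have h : Near r 0 θ := by simpa [displacements] using hθ
    choose z hz hθz using h
    refine Finset.mem_image.mpr ⟨z, ?_, ?_⟩
    · simp only [Z, Fintype.mem_piFinset, Finset.mem_Icc]
      intro i l
      have := hz i l
      omega
    · funext i l
      simp [hθz]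
  refine (Finset.card_le_card hsub).trans (Finset.card_image_le.trans (le_of_eq ?_))
  simp only [Z, Fintype.card_piFinset, Int.card_Icc, Finset.prod_const, Finset.card_univ,
    Fintype.card_fin]
  rw [← pow_mul, mul_comm d k]
  congr 1
  omega

theorem sub_mem_displacements {r : ℕ} {a b : Fin k → Fin d → ZMod N} (h : Near r a b) :
    b - a ∈ displacements N k d r := by
  simp only [displacements, Finset.mem_filter, Finset.mem_univ, true_and]
  intro i l
  obtain ⟨z, hz, h⟩ := h i l
  exact ⟨z, hz, by simp [h]⟩

/-- The contribution of the steps out of `a` to the Dirichlet form. -/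
def localEnergy (h : (Fin k → Fin d → ZMod N) → ℝ) (a : Fin k → Fin d → ZMod N) : ℝ :=
  ∑ b, if Step a b then (h a - h b) ^ 2 else 0

theorem localEnergy_nonneg (h : (Fin k → Fin d → ZMod N) → ℝ) (a : Fin k → Fin d → ZMod N) :
    0 ≤ localEnergy h a :=
  Finset.sum_nonneg fun b _ => by split_ifs <;> positivity

/-- The contribution to the Dirichlet form of the steps in a neighbourhood of `x`. -/
def ballEnergy (M : ℕ) (h : (Fin k → Fin d → ZMod N) → ℝ) (x : Fin k → Fin d → ZMod N) : ℝ :=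
  ∑ θ ∈ displacements N k d M, localEnergy h (x + θ)

theorem ballEnergy_nonneg (M : ℕ) (h : (Fin k → Fin d → ZMod N) → ℝ)
    (x : Fin k → Fin d → ZMod N) : 0 ≤ ballEnergy M h x :=
  Finset.sum_nonneg fun _ _ => localEnergy_nonneg h _

theorem sum_ballEnergy (M : ℕ) (h : (Fin k → Fin d → ZMod N) → ℝ) :
    ∑ x, ballEnergy M h x = (displacements N k d M).card * ∑ a, localEnergy h a := by
  unfold ballEnergy
  rw [Finset.sum_comm, ← nsmul_eq_mul, ← Finset.sum_const]
  exact Finset.sum_congr rfl fun θ _ => Equiv.sum_comp (Equiv.addRight θ) (localEnergy h)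

theorem sq_sub_le_ballEnergy {r M : ℕ} (h : (Fin k → Fin d → ZMod N) → ℝ)
    {x a b : Fin k → Fin d → ZMod N} (hr : Near r x a) (hs : Step a b) (hM : r ≤ M) :
    (h a - h b) ^ 2 ≤ ballEnergy M h x := by
  have h1 : (h a - h b) ^ 2 ≤ localEnergy h a := by
    have := Finset.single_le_sum (f := fun b => if Step a b then (h a - h b) ^ 2 else 0)
      (fun b _ => by split_ifs <;> positivity) (Finset.mem_univ b)
    simpa [hs, localEnergy] using this
  refine h1.trans ?_
  have := Finset.single_le_sum (f := fun θ => localEnergy h (x + θ))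
    (fun θ _ => localEnergy_nonneg h _) (sub_mem_displacements (hr.mono hM))
  simpa [ballEnergy] using this

theorem Reach.abs_sub_le {r m M : ℕ} (h : (Fin k → Fin d → ZMod N) → ℝ)
    {x a b : Fin k → Fin d → ZMod N} (hr : Near r x a) (hab : Reach m a b) (hM : r + m ≤ M) :
    |h a - h b| ≤ m * √(ballEnergy M h x) := by
  induction m generalizing b with
  | zero =>
    have : a = b := hab
    simp [this]
  | succ m ih =>
    obtain ⟨c, hc, hcb⟩ := hab
    have h1 := ih hc (by omega)
    have h2 : |h c - h b| ≤ √(ballEnergy M h x) := by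
      rcases hcb with rfl | hs
      · simp
      · exact Real.abs_le_sqrt (sq_sub_le_ballEnergy h (hr.trans hc.near) hs (by omega))
    have h3 := _root_.abs_sub_le (h a) (h c) (h b)
    push_cast
    linarith

theorem Reach.sq_sub_le {r m M : ℕ} (h : (Fin k → Fin d → ZMod N) → ℝ)
    {x a b : Fin k → Fin d → ZMod N} (hr : Near r x a) (hab : Reach m a b) (hM : r + m ≤ M) :
    (h a - h b) ^ 2 ≤ (M : ℝ) ^ 2 * ballEnergy M h x := by
  have h1 := hab.abs_sub_le h hr hM
  have h2 : (m : ℝ) * √(ballEnergy M h x) ≤ M * √(ballEnergy M h x) := by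
    gcongr
    omega
  have h3 := pow_le_pow_left₀ (abs_nonneg _) (h1.trans h2) 2
  rwa [sq_abs, mul_pow, Real.sq_sqrt (ballEnergy_nonneg M h x)] at h3

/-- The `ℓ²`-norm of the increment of `F` under translation by `w`. -/
def incr {W : Type*} [Fintype W] [Add W] (F : W → ℝ) (w : W) : ℝ :=
  ‖WithLp.toLp 2 fun x => F (x + w) - F x‖

theorem incr_sq {W : Type*} [Fintype W] [Add W] (F : W → ℝ) (w : W) :
    incr F w ^ 2 = ∑ x, (F (x + w) - F x) ^ 2 := by
  simp [incr, EuclideanSpace.norm_sq_eq]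

theorem incr_nonneg {W : Type*} [Fintype W] [Add W] (F : W → ℝ) (w : W) : 0 ≤ incr F w :=
  norm_nonneg _

theorem incr_zero {W : Type*} [Fintype W] [AddCommGroup W] (F : W → ℝ) : incr F 0 = 0 := by
  have := incr_sq F 0
  simpa using this

theorem incr_add_le {W : Type*} [Fintype W] [AddCommGroup W] (F : W → ℝ) (w w' : W) :
    incr F (w + w') ≤ incr F w + incr F w' := by
  have h : ‖WithLp.toLp 2 fun x => F (x + w + w') - F (x + w)‖ = incr F w' := by
    rw [← sq_eq_sq₀ (norm_nonneg _) (incr_nonneg _ _), incr_sq, EuclideanSpace.norm_sq_eq]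
    simp only [Real.norm_eq_abs, sq_abs]
    exact Equiv.sum_comp (Equiv.addRight w) fun x => (F (x + w') - F x) ^ 2
  rw [add_comm, ← h]
  unfold incr
  refine le_trans (le_of_eq ?_) (norm_add_le _ _)
  congr 1
  ext x
  simp [add_assoc, add_comm w w']

theorem incr_nsmul_le {W : Type*} [Fintype W] [AddCommGroup W] (F : W → ℝ) (m : ℕ) (e : W) :
    incr F (m • e) ≤ m * incr F e := by
  induction m with
  | zero => simp [incr_zero]
  | succ m ih =>
    rw [succ_nsmul]
    refine (incr_add_le F _ _).trans ?_
    push_cast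
    linarith

/-- Poincaré inequality on the torus of all configurations. -/
theorem torus_poincare (F : (Fin k → Fin d → ZMod N) → ℝ) :
    ∑ x, ∑ y, (F x - F y) ^ 2 ≤
      Fintype.card (Fin k → Fin d → ZMod N) * ((k * d : ℕ) * (N : ℝ) ^ 2 *
        ∑ q : Fin k × Fin d, ∑ x, (F (x + bump q.1 q.2 1) - F x) ^ 2) := by
  have h1 : ∀ w, incr F w ≤ ∑ q : Fin k × Fin d, (N : ℝ) * incr F (bump q.1 q.2 1) := by
    intro w
    conv_lhs => rw [← sum_bump w]
    refine (Finset.le_sum_of_subadditive (incr F) (incr_zero F).le (incr_add_le F) _ _).trans ?_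
    refine Finset.sum_le_sum fun q _ => ?_
    rw [← ZMod.natCast_zmod_val (w q.1 q.2), bump_natCast]
    refine (incr_nsmul_le F _ _).trans ?_
    have := incr_nonneg F (bump q.1 q.2 (1 : ZMod N))
    gcongr
    exact (ZMod.val_lt _).le
  have h2 : ∀ w, ∑ x, (F (x + w) - F x) ^ 2 ≤ (k * d : ℕ) * (N : ℝ) ^ 2 *
        ∑ q : Fin k × Fin d, ∑ x, (F (x + bump q.1 q.2 1) - F x) ^ 2 := by
    intro w
    rw [← incr_sq]
    refine (pow_le_pow_left₀ (incr_nonneg F w) (h1 w) 2).trans ?_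
    refine sq_sum_le_card_mul_sum_sq.trans (le_of_eq ?_)
    simp only [mul_pow, incr_sq, ← Finset.mul_sum]
    simp [mul_assoc]
  have h3 : ∑ x, ∑ y, (F x - F y) ^ 2 = ∑ w, ∑ x, (F (x + w) - F x) ^ 2 := by
    rw [Finset.sum_comm (f := fun w x => (F (x + w) - F x) ^ 2)]
    refine Finset.sum_congr rfl fun x _ => ?_
    rw [← Equiv.sum_comp (Equiv.addLeft x)]
    exact Finset.sum_congr rfl fun y _ => by rw [Equiv.coe_addLeft]; ring
  rw [h3, ← nsmul_eq_mul, Fintype.card, ← Finset.sum_const]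
  exact Finset.sum_le_sum fun w _ => h2 w

/-- Range of the local comparison between nearby configurations. -/
def comparisonRadius (k d : ℕ) : ℕ :=
  3 * k + 3 * (k * d * (6 * k + 1 + 3 * k)) + k * (3 * k)

/-- Constant in the Poincaré inequality for labelled configurations. -/
def labelledConst (k d : ℕ) : ℝ :=
  3 * (comparisonRadius k d : ℝ) ^ 2 * (2 + (k * d : ℕ) ^ 2) *
    ((2 * comparisonRadius k d + 1) ^ (k * d) : ℕ)

/-- Poincaré inequality for labelled admissible configurations. -/
theorem labelled_poincare (hN : k * (3 * k + 1) < N) (hN2 : 2 ≤ N) {j j' : Fin d} (hj : j ≠ j')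
    (h : (Fin k → Fin d → ZMod N) → ℝ) :
    ∑ x, ∑ y, (if Admissible x ∧ Admissible y then (h x - h y) ^ 2 else 0) ≤
      labelledConst k d * Fintype.card (Fin k → Fin d → ZMod N) * (N : ℝ) ^ 2 *
        ∑ a, localEnergy h a := by
  choose S hS hSn _ hSr using fun x : Fin k → Fin d → ZMod N => exists_shift hN hN2 x j
  set M := comparisonRadius k d with hM
  have hMdef : M = 3 * k + 3 * (k * d * (6 * k + 1 + 3 * k)) + k * (3 * k) := rfl
  set F := fun x => h (S x) with hF
  set G := ballEnergy M h with hG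
  have hG0 : ∀ x, 0 ≤ G x := ballEnergy_nonneg M h
  have hinc : ∀ (q : Fin k × Fin d) x,
      (F (x + bump q.1 q.2 1) - F x) ^ 2 ≤ (M : ℝ) ^ 2 * G x := by
    intro q x
    have hnear : Near (6 * k + 1) (S x) (S (x + bump q.1 q.2 1)) :=
      (((hSn x).symm.trans (near_bump x q.1 q.2)).trans (hSn _)).mono (by omega)
    have := (reach_of_separated hN hN2 hj (hS _) (hS _) hnear).sq_sub_le (M := M) h (hSn x)
      (by omega)
    rwa [← neg_sub, neg_sq] at this
  have hadm : ∀ x, Admissible x → (h x - F x) ^ 2 ≤ (M : ℝ) ^ 2 * G x := fun x hx =>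
    (hSr x hx).sq_sub_le (M := M) h (Near.refl 0 x) (by omega)
  have hpt : ∀ x y, (if Admissible x ∧ Admissible y then (h x - h y) ^ 2 else 0) ≤
      3 * ((M : ℝ) ^ 2 * G x) + 3 * ((M : ℝ) ^ 2 * G y) + 3 * (F x - F y) ^ 2 := by
    intro x y
    have hx0 := mul_nonneg (sq_nonneg (M : ℝ)) (hG0 x)
    have hy0 := mul_nonneg (sq_nonneg (M : ℝ)) (hG0 y)
    split_ifs with hxy
    · have hx := hadm x hxy.1
      have hy := hadm y hxy.2
      nlinarith [sq_nonneg ((h x - F x) - (F x - F y)), sq_nonneg ((h x - F x) + (h y - F y)),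
        sq_nonneg ((F x - F y) + (h y - F y))]
    · positivity
  have hP := torus_poincare F
  have hE : ∑ q : Fin k × Fin d, ∑ x, (F (x + bump q.1 q.2 1) - F x) ^ 2 ≤
      (k * d : ℕ) * ((M : ℝ) ^ 2 * ∑ x, G x) := by
    refine (Finset.sum_le_sum fun q _ => Finset.sum_le_sum fun x _ => hinc q x).trans ?_
    simp [← Finset.mul_sum]
  set w : ℝ := (Fintype.card (Fin k → Fin d → ZMod N) : ℝ) with hw
  have hw0 : 0 ≤ w := Nat.cast_nonneg _
  have hsum : ∑ x, ∑ y, (if Admissible x ∧ Admissible y then (h x - h y) ^ 2 else 0) ≤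
      6 * w * ((M : ℝ) ^ 2 * ∑ x, G x) + 3 * ∑ x, ∑ y, (F x - F y) ^ 2 := by
    refine (Finset.sum_le_sum fun x _ => Finset.sum_le_sum fun y _ => hpt x y).trans
      (le_of_eq ?_)
    simp only [Finset.sum_add_distrib, Finset.sum_const, ← Finset.mul_sum, nsmul_eq_mul,
      Finset.card_univ, ← hw]
    ring
  have hN1 : (1 : ℝ) ≤ (N : ℝ) ^ 2 := one_le_pow₀ (by exact_mod_cast (by omega : 1 ≤ N))
  have hL0 : 0 ≤ ∑ a, localEnergy h a := Finset.sum_nonneg fun a _ => localEnergy_nonneg h a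
  have hGs : ∑ x, G x ≤ ((2 * M + 1) ^ (k * d) : ℕ) * ∑ a, localEnergy h a := by
    rw [hG, sum_ballEnergy]
    gcongr
    exact card_displacements_le M
  have hGs0 : 0 ≤ ∑ x, G x := Finset.sum_nonneg fun x _ => hG0 x
  have hPE : ∑ x, ∑ y, (F x - F y) ^ 2 ≤
      w * ((k * d : ℕ) * (N : ℝ) ^ 2 * ((k * d : ℕ) * ((M : ℝ) ^ 2 * ∑ x, G x))) :=
    hP.trans (by gcongr)
  generalize ∑ x, G x = T at hsum hGs hGs0 hPE
  calc _ ≤ 6 * w * ((M : ℝ) ^ 2 * T) +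
        3 * (w * ((k * d : ℕ) * (N : ℝ) ^ 2 * ((k * d : ℕ) * ((M : ℝ) ^ 2 * T)))) :=
        hsum.trans (by gcongr)
    _ ≤ 6 * w * ((M : ℝ) ^ 2 * T) * (N : ℝ) ^ 2 +
        3 * (w * ((k * d : ℕ) * (N : ℝ) ^ 2 * ((k * d : ℕ) * ((M : ℝ) ^ 2 * T)))) := by
        exact add_le_add (le_mul_of_one_le_right (by positivity) hN1) le_rfl
    _ = 3 * (M : ℝ) ^ 2 * (2 + (k * d : ℕ) ^ 2) * w * (N : ℝ) ^ 2 * T := by ring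
    _ ≤ 3 * (M : ℝ) ^ 2 * (2 + (k * d : ℕ) ^ 2) * w * (N : ℝ) ^ 2 *
        (((2 * M + 1) ^ (k * d) : ℕ) * ∑ a, localEnergy h a) := by gcongr
    _ = _ := by unfold labelledConst; rw [← hM]; ring

end Energy

section Unlabelled

variable {N k d : ℕ}

theorem Admissible.injective {a : Fin k → Fin d → ZMod N} (h : Admissible a) :
    Function.Injective a := by
  intro i i' hi
  by_contra hne
  exact (h i i' hne).1 hi

theorem Step.ne {a b : Fin k → Fin d → ZMod N} {i : Fin k} (ha : Admissible a)
    (hadj : (torusGraph N d).Adj (a i) (b i)) (hoff : ∀ i', i' ≠ i → b i' = a i') (i' : Fin k) :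
    b i' ≠ a i := by
  intro h
  by_cases hi : i' = i
  · subst hi
    exact hadj.ne h.symm
  · rw [hoff i' hi] at h
    exact hi (ha.injective h)

variable [NeZero N]

theorem card_adj_torusGraph_le (u : Fin d → ZMod N) :
    (univ.filter fun v => (torusGraph N d).Adj u v).card ≤ 2 * d := by
  have hsub : (univ.filter fun v => (torusGraph N d).Adj u v) ⊆
      (univ.image fun j : Fin d => u + Pi.single j 1) ∪
        univ.image fun j : Fin d => u - Pi.single j 1 := by
    intro v hv
    simp only [Finset.mem_filter, Finset.mem_univ, true_and, torusGraph_adj] at hv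
    simp only [Finset.mem_union, Finset.mem_image, Finset.mem_univ, true_and]
    rcases hv.2 with ⟨j, hj⟩ | ⟨j, hj⟩
    · exact Or.inl ⟨j, hj.symm⟩
    · exact Or.inr ⟨j, by rw [hj]; simp⟩
  refine (Finset.card_le_card hsub).trans ((Finset.card_union_le _ _).trans ?_)
  have h1 := Finset.card_image_le (s := univ) (f := fun j : Fin d => u + Pi.single j 1)
  have h2 := Finset.card_image_le (s := univ) (f := fun j : Fin d => u - Pi.single j 1)
  simp only [Finset.card_univ, Fintype.card_fin] at h1 h2
  omega

/-- Labelled configurations with no two particles equal or adjacent. -/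
abbrev Labelled (N d k : ℕ) : Type := {a : Fin k → Fin d → ZMod N // Admissible a}

/-- The unlabelled configuration of occupied vertices. -/
def occupied (a : Labelled N d k) : OmegaK (torusGraph N d) k :=
  ⟨fun v => decide (∃ i, a.1 i = v), by
    constructor
    · have : (univ.filter fun v => decide (∃ i, a.1 i = v) = true) = univ.image a.1 := by
        ext v
        simp
      unfold numParticles
      rw [this, Finset.card_image_of_injective _ a.2.injective]
      simp
    · rintro u v hadj ⟨hu, hv⟩
      obtain ⟨i, rfl⟩ := of_decide_eq_true hu
      obtain ⟨i', rfl⟩ := of_decide_eq_true hv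
      by_cases hi : i = i'
      · exact hadj.ne (by rw [hi])
      · exact (a.2 i i' hi).2 hadj⟩

theorem occupied_apply (a : Labelled N d k) (v : Fin d → ZMod N) :
    (occupied a).1 v = true ↔ ∃ i, a.1 i = v := by
  simp [occupied]

theorem occupied_surjective :
    Function.Surjective (occupied : Labelled N d k → OmegaK (torusGraph N d) k) := by
  rintro ⟨x, hx, hadj⟩
  have hcard : Fintype.card {v // x v = true} = k := by
    rw [Fintype.card_subtype]
    exact hx
  let e : Fin k ≃ {v // x v = true} := (Fintype.equivFinOfCardEq hcard).symm
  refine ⟨⟨fun i => (e i).1, fun i i' hi => ⟨fun h => hi (e.injective (Subtype.ext h)),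
    fun h => hadj _ _ h ⟨(e i).2, (e i').2⟩⟩⟩, ?_⟩
  apply Subtype.ext
  funext v
  rw [Bool.eq_iff_iff, occupied_apply]
  constructor
  · rintro ⟨i, rfl⟩
    exact (e i).2
  · intro hv
    exact ⟨e.symm ⟨v, hv⟩, by simp⟩

theorem exists_comp_of_occupied_eq {a b : Labelled N d k} (h : occupied a = occupied b) :
    ∃ σ : Fin k → Fin k, a.1 = b.1 ∘ σ := by
  have : ∀ i, ∃ i', b.1 i' = a.1 i := fun i => by
    rw [← occupied_apply, ← h, occupied_apply]
    exact ⟨i, rfl⟩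
  choose σ hσ using this
  exact ⟨σ, funext fun i => (hσ i).symm⟩

theorem card_fiber_le {α : Type*} [Fintype α] (g : α → Labelled N d k) (r : ℕ)
    (e : α → Fin k → Fin d → ZMod N) (he : Function.Injective e)
    (hg : ∀ x, Near r (e x) (g x).1) (s : OmegaK (torusGraph N d) k) :
    (univ.filter fun x => occupied (g x) = s).card ≤
      k ^ k * (2 * r + 1) ^ (k * d) := by
  rcases (univ.filter fun x => occupied (g x) = s).eq_empty_or_nonempty with h0 | ⟨x₀, hx₀⟩
  · rw [h0]; simp
  have hx₀' : occupied (g x₀) = s := by simpa using hx₀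
  rw [← Finset.card_image_of_injective _ he]
  have hsub : (univ.filter fun x => occupied (g x) = s).image e ⊆
      ((univ : Finset (Fin k → Fin k)) ×ˢ displacements N k d r).image
        fun q => (g x₀).1 ∘ q.1 - q.2 := by
    intro y hy
    obtain ⟨x, hx, rfl⟩ := Finset.mem_image.mp hy
    have hx' : occupied (g x) = s := by simpa using hx
    obtain ⟨σ, hσ⟩ := exists_comp_of_occupied_eq (hx'.trans hx₀'.symm)
    refine Finset.mem_image.mpr ⟨(σ, (g x).1 - e x), ?_, ?_⟩
    · exact Finset.mem_product.mpr ⟨Finset.mem_univ _, sub_mem_displacements (hg x)⟩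
    · dsimp only
      rw [← hσ, sub_sub_cancel]
  refine (Finset.card_le_card hsub).trans (Finset.card_image_le.trans ?_)
  rw [Finset.card_product, Finset.card_univ, Fintype.card_fun, Fintype.card_fin]
  exact Nat.mul_le_mul_left _ (card_displacements_le r)

theorem sum_occupied_le (φ : OmegaK (torusGraph N d) k → ℝ) (hφ : ∀ s, 0 ≤ φ s) :
    ∑ a : Labelled N d k, φ (occupied a) ≤ (k ^ k : ℕ) * ∑ s, φ s := by
  rw [← Finset.sum_fiberwise univ (occupied : Labelled N d k → _), Finset.mul_sum]
  refine Finset.sum_le_sum fun s _ => ?_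
  have hc := card_fiber_le (id : Labelled N d k → _) 0 Subtype.val Subtype.val_injective
    (fun x => Near.refl 0 _) s
  calc ∑ a ∈ univ.filter fun a : Labelled N d k => occupied a = s, φ (occupied a)
      = ∑ a ∈ univ.filter fun a : Labelled N d k => occupied a = s, φ s :=
        Finset.sum_congr rfl fun a ha => by rw [(Finset.mem_filter.mp ha).2]
    _ = ((univ.filter fun a : Labelled N d k => occupied a = s).card : ℝ) * φ s := by
        rw [Finset.sum_const, nsmul_eq_mul]
    _ ≤ (k ^ k : ℕ) * φ s := by
        refine mul_le_mul_of_nonneg_right (Nat.cast_le.mpr ?_) (hφ s)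
        simpa using hc

theorem sum_le_sum_occupied (φ : OmegaK (torusGraph N d) k → ℝ) (hφ : ∀ s, 0 ≤ φ s) :
    ∑ s, φ s ≤ ∑ a : Labelled N d k, φ (occupied a) := by
  obtain ⟨g, hg⟩ := (occupied_surjective (N := N) (d := d) (k := k)).hasRightInverse
  have hinj : Function.Injective g := hg.injective
  calc ∑ s, φ s = ∑ s, φ (occupied (g s)) := Finset.sum_congr rfl fun s _ => by rw [hg s]
    _ = ∑ a ∈ univ.map ⟨g, hinj⟩, φ (occupied a) := by rw [Finset.sum_map]; rfl
    _ ≤ ∑ a : Labelled N d k, φ (occupied a) :=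
        Finset.sum_le_sum_of_subset_of_nonneg (Finset.subset_univ _) fun a _ _ => hφ _

theorem card_tuples_le (hN : k * (3 * k + 1) < N) (hN2 : 2 ≤ N) (j : Fin d) :
    Fintype.card (Fin k → Fin d → ZMod N) ≤
      k ^ k * (2 * (3 * k) + 1) ^ (k * d) * Fintype.card (OmegaK (torusGraph N d) k) := by
  choose S hS hSn _ _ using fun x : Fin k → Fin d → ZMod N => exists_shift hN hN2 x j
  exact Finset.card_le_mul_card_image_of_maps_to
    (f := fun x => occupied (⟨S x, (hS x).admissible⟩ : Labelled N d k))
    (fun x _ => Finset.mem_univ _) _ fun s _ => card_fiber_le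
      (fun x => (⟨S x, (hS x).admissible⟩ : Labelled N d k)) (3 * k) id Function.injective_id
      hSn s

theorem card_omegaK_le :
    Fintype.card (OmegaK (torusGraph N d) k) ≤ Fintype.card (Fin d → ZMod N) ^ k := by
  refine (Fintype.card_le_of_surjective _ (occupied_surjective (N := N) (d := d))).trans ?_
  refine (Fintype.card_subtype_le _).trans (le_of_eq ?_)
  rw [Fintype.card_fun, Fintype.card_fin]

theorem Step.traceKernel_ge {p : ℝ} (hp0 : 0 < p) (hp1 : p < 1) (hd : 0 < d)
    {a b : Labelled N d k} (h : Step a.1 b.1) :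
    p * (1 - p) / ((k + 1) * (2 * d : ℕ) * Fintype.card (Fin d → ZMod N)) ≤
      traceKernel (torusGraph N d) p k (occupied a) (occupied b) := by
  obtain ⟨ha, hb, i, hadj, hoff⟩ := h
  have hne := Step.ne ha hadj hoff
  have hne' : ∀ i', a.1 i' ≠ b.1 i :=
    Step.ne hb hadj.symm fun i' hi => (hoff i' hi).symm
  refine traceKernel_move_ge (torusGraph N d) p hp0 hp1 k (2 * d) (by omega)
    card_adj_torusGraph_le _ _ (a.1 i) (b.1 i) hadj ?_ ?_ ?_
  · rw [occupied_apply]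
    exact ⟨i, rfl⟩
  · rw [Bool.eq_false_iff, Ne, occupied_apply]
    rintro ⟨i', hi'⟩
    exact hne' i' hi'
  · funext w
    rw [Bool.eq_iff_iff, occupied_apply]
    by_cases hu : w = a.1 i
    · subst hu
      simp [hne]
    · unfold Function.update
      rw [dif_neg hu]
      by_cases hv : w = b.1 i
      · subst hv
        simp
      · rw [dif_neg hv, occupied_apply]
        have hi : ∀ i', (b.1 i' = w ↔ a.1 i' = w) := fun i' => by
          by_cases hi' : i' = i
          · subst hi'
            exact ⟨fun h => absurd h.symm hv, fun h => absurd h.symm hu⟩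
          · rw [hoff i' hi']
        simp only [hi]

/-- Constant in the Poincaré inequality on `Ω_k`. -/
def omegaConst (k d : ℕ) : ℝ :=
  labelledConst k d * ((k ^ k) ^ 3 * (2 * (3 * k) + 1) ^ (k * d) : ℕ)

theorem labelledConst_nonneg (k d : ℕ) : 0 ≤ labelledConst k d := by
  unfold labelledConst
  positivity

theorem omegaConst_nonneg (k d : ℕ) : 0 ≤ omegaConst k d :=
  mul_nonneg (labelledConst_nonneg k d) (Nat.cast_nonneg _)

theorem sum_sum_eq_labelled (Φ : (Fin k → Fin d → ZMod N) → (Fin k → Fin d → ZMod N) → ℝ)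
    (hΦ : ∀ x y, ¬(Admissible x ∧ Admissible y) → Φ x y = 0) :
    ∑ x, ∑ y, Φ x y = ∑ a : Labelled N d k, ∑ b : Labelled N d k, Φ a.1 b.1 := by
  have h : ∀ g : (Fin k → Fin d → ZMod N) → ℝ, (∀ x, ¬Admissible x → g x = 0) →
      ∑ x, g x = ∑ a : Labelled N d k, g a.1 := by
    intro g hg
    rw [← Finset.sum_subtype (univ.filter Admissible) (by simp) g, Finset.sum_filter]
    refine Finset.sum_congr rfl fun x _ => ?_
    split_ifs with hx
    · rfl
    · exact hg x hx
  rw [h _ fun x hx => Finset.sum_eq_zero fun y _ => hΦ x y fun hxy => hx hxy.1]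
  exact Finset.sum_congr rfl fun a _ => h _ fun y hy => hΦ _ y fun hxy => hy hxy.2

/-- Poincaré inequality for the trace chain on `Ω_k`. -/
theorem omegaK_poincare {p : ℝ} (hp0 : 0 < p) (hp1 : p < 1) (hN : k * (3 * k + 1) < N)
    (hN2 : 2 ≤ N) (hd : 2 ≤ d) (f : OmegaK (torusGraph N d) k → ℝ) :
    ∑ x, ∑ y, (f x - f y) ^ 2 ≤
      omegaConst k d * (N : ℝ) ^ 2 *
        ((k + 1) * (2 * d : ℕ) * Fintype.card (Fin d → ZMod N) / (p * (1 - p))) *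
        Fintype.card (OmegaK (torusGraph N d) k) *
        ∑ x, ∑ y, traceKernel (torusGraph N d) p k x y * (f x - f y) ^ 2 := by
  set K := traceKernel (torusGraph N d) p k with hK
  have hK0 : ∀ x y, 0 ≤ K x y := traceKernel_nonneg (torusGraph N d) p hp0.le hp1.le k
  set κ : ℝ := p * (1 - p) / ((k + 1) * (2 * d : ℕ) * Fintype.card (Fin d → ZMod N)) with hκ
  have hcard : (0 : ℝ) < Fintype.card (Fin d → ZMod N) := Nat.cast_pos.mpr Fintype.card_pos
  have hd0 : (0 : ℝ) < (2 * d : ℕ) := Nat.cast_pos.mpr (by omega)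
  have hκ0 : 0 < κ := div_pos (mul_pos hp0 (by linarith)) (by positivity)
  have hκinv : (k + 1) * (2 * d : ℕ) * Fintype.card (Fin d → ZMod N) / (p * (1 - p)) = κ⁻¹ := by
    rw [hκ, inv_div]
  let h : (Fin k → Fin d → ZMod N) → ℝ :=
    fun x => if hx : Admissible x then f (occupied ⟨x, hx⟩) else 0
  have hh : ∀ a : Labelled N d k, h a.1 = f (occupied a) := fun a => dif_pos a.2
  have hL : ∑ x, ∑ y, (f x - f y) ^ 2 ≤
      ∑ x, ∑ y, (if Admissible x ∧ Admissible y then (h x - h y) ^ 2 else 0) := by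
    rw [sum_sum_eq_labelled _ fun x y hxy => if_neg hxy]
    refine (sum_le_sum_occupied _ fun s => Finset.sum_nonneg fun _ _ => sq_nonneg _).trans ?_
    refine Finset.sum_le_sum fun a _ => ?_
    refine (sum_le_sum_occupied _ fun s => sq_nonneg _).trans (le_of_eq ?_)
    exact Finset.sum_congr rfl fun b _ => by rw [if_pos ⟨a.2, b.2⟩, hh, hh]
  have hE : ∑ a, localEnergy h a ≤
      κ⁻¹ * ((k ^ k : ℕ) * ((k ^ k : ℕ) * ∑ x, ∑ y, K x y * (f x - f y) ^ 2)) := by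
    unfold localEnergy
    rw [sum_sum_eq_labelled _ fun x y hxy => if_neg fun hs => hxy ⟨hs.1, hs.2.1⟩]
    have h1 : ∀ a b : Labelled N d k, (if Step a.1 b.1 then (h a.1 - h b.1) ^ 2 else 0) ≤
        κ⁻¹ * (K (occupied a) (occupied b) * (f (occupied a) - f (occupied b)) ^ 2) := by
      intro a b
      split_ifs with hs
      · rw [hh, hh, ← mul_assoc]
        refine le_mul_of_one_le_left (sq_nonneg _) ?_
        rw [inv_mul_eq_div, one_le_div hκ0]
        exact hs.traceKernel_ge hp0 hp1 (by omega)
      · exact mul_nonneg (inv_nonneg.mpr hκ0.le) (mul_nonneg (hK0 _ _) (sq_nonneg _))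
    refine (Finset.sum_le_sum fun a _ => Finset.sum_le_sum fun b _ => h1 a b).trans ?_
    simp only [← Finset.mul_sum]
    refine mul_le_mul_of_nonneg_left ?_ (inv_nonneg.mpr hκ0.le)
    have h2 : ∀ s, ∑ b : Labelled N d k, K s (occupied b) * (f s - f (occupied b)) ^ 2 ≤
        (k ^ k : ℕ) * ∑ y, K s y * (f s - f y) ^ 2 := fun s =>
      sum_occupied_le (fun y => K s y * (f s - f y) ^ 2)
        fun y => mul_nonneg (hK0 _ _) (sq_nonneg _)
    refine (Finset.sum_le_sum fun a _ => h2 (occupied a)).trans ?_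
    rw [← Finset.mul_sum]
    refine mul_le_mul_of_nonneg_left ?_ (Nat.cast_nonneg _)
    exact sum_occupied_le (fun s => ∑ y, K s y * (f s - f y) ^ 2)
      fun s => Finset.sum_nonneg fun y _ => mul_nonneg (hK0 _ _) (sq_nonneg _)
  have hW : (Fintype.card (Fin k → Fin d → ZMod N) : ℝ) ≤
      (k ^ k * (2 * (3 * k) + 1) ^ (k * d) : ℕ) * Fintype.card (OmegaK (torusGraph N d) k) := by
    exact_mod_cast card_tuples_le hN hN2 (⟨0, by omega⟩ : Fin d)
  have hj : (⟨0, by omega⟩ : Fin d) ≠ ⟨1, by omega⟩ := by simp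
  rw [hκinv]
  have hQ0 : 0 ≤ ∑ x, ∑ y, K x y * (f x - f y) ^ 2 :=
    Finset.sum_nonneg fun x _ => Finset.sum_nonneg fun y _ => mul_nonneg (hK0 _ _) (sq_nonneg _)
  have hE0 : 0 ≤ ∑ a, localEnergy h a := Finset.sum_nonneg fun a _ => localEnergy_nonneg h a
  have hC := labelledConst_nonneg k d
  have hP := hL.trans (labelled_poincare hN hN2 hj h)
  generalize ∑ x, ∑ y, K x y * (f x - f y) ^ 2 = Q at *
  generalize ∑ a, localEnergy h a = E at *
  calc _ ≤ _ := hP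
    _ ≤ labelledConst k d * ((k ^ k * (2 * (3 * k) + 1) ^ (k * d) : ℕ) *
          Fintype.card (OmegaK (torusGraph N d) k)) * (N : ℝ) ^ 2 *
        (κ⁻¹ * ((k ^ k : ℕ) * ((k ^ k : ℕ) * Q))) := by gcongr
    _ = _ := by unfold omegaConst; push_cast; ring

end Unlabelled

section Asymptotics

theorem mixingTime_le_log {Ω : Type*} [Fintype Ω] (K : Ω → Ω → ℝ) (h0 : ∀ x y, 0 ≤ K x y)
    (hsymm : ∀ x y, K x y = K y x) (hrow : ∀ x, ∑ y, K x y ≤ 1) (hlazy : ∀ x, 1 / 2 ≤ K x x)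
    (A : ℝ) (hA : 1 ≤ A)
    (hP : ∀ f : Ω → ℝ, ∑ x, ∑ y, (f x - f y) ^ 2 ≤
      A * Fintype.card Ω * ∑ x, ∑ y, K x y * (f x - f y) ^ 2)
    {n : ℝ} (hn : 1 ≤ Real.log n) (hn0 : 0 < n) {k : ℕ} (hcard : (Fintype.card Ω : ℝ) ≤ n ^ k) :
    (mixingTime K (unifDist Ω) : ℝ) ≤ (Real.log 16 + k + 2) * A * Real.log n := by
  have hA0 : 0 < A := by linarith
  have h16 : 0 < Real.log 16 := Real.log_pos (by norm_num)
  set B := A * (Real.log 16 + k * Real.log n) with hB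
  have hB0 : 0 ≤ B := by positivity
  have hlt : B < (⌈B⌉₊ + 1 : ℕ) := by
    push_cast
    linarith [Nat.le_ceil B]
  have hsmall : (Fintype.card Ω : ℝ) * (1 - 1 / A) ^ (⌈B⌉₊ + 1) < 1 / 16 := by
    have hA1 : 0 ≤ 1 - 1 / A := by
      rw [sub_nonneg, div_le_one hA0]
      exact hA
    have h1 : (1 - 1 / A) ^ (⌈B⌉₊ + 1) ≤ Real.exp (-(1 / A)) ^ (⌈B⌉₊ + 1) :=
      pow_le_pow_left₀ hA1 (by linarith [Real.add_one_le_exp (-(1 / A))]) _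
    have h2 : Real.exp (-(1 / A)) ^ (⌈B⌉₊ + 1) < Real.exp (-(Real.log 16 + k * Real.log n)) := by
      rw [← Real.exp_nat_mul, Real.exp_lt_exp, mul_neg, neg_lt_neg_iff, mul_one_div,
        lt_div_iff₀ hA0, mul_comm]
      exact hlt
    have h3 : Real.exp (-(Real.log 16 + k * Real.log n)) = 1 / 16 * (n ^ k)⁻¹ := by
      rw [Real.exp_neg, Real.exp_add, Real.exp_log (by norm_num), mul_comm (k : ℝ), Real.exp_mul,
        Real.exp_log hn0, Real.rpow_natCast, mul_inv]
      norm_num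
    have hnk : 0 < n ^ k := pow_pos hn0 k
    calc _ ≤ n ^ k * Real.exp (-(1 / A)) ^ (⌈B⌉₊ + 1) := by gcongr
      _ < n ^ k * (1 / 16 * (n ^ k)⁻¹) := by
          rw [← h3]
          exact mul_lt_mul_of_pos_left h2 hnk
      _ = 1 / 16 := by field_simp
  have hmix := mixingTime_le_of_poincare K h0 hsymm hrow hlazy A hA hP (⌈B⌉₊ + 1)
    (Nat.succ_pos _) hsmall
  have hceil : ((⌈B⌉₊ + 1 : ℕ) : ℝ) ≤ B + 2 := by
    push_cast
    linarith [Nat.ceil_lt_add_one hB0]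
  have hAn : 1 ≤ A * Real.log n := one_le_mul_of_one_le_of_one_le hA hn
  have hAl : A * Real.log 16 ≤ A * Real.log 16 * Real.log n :=
    le_mul_of_one_le_right (by positivity) hn
  calc (mixingTime K (unifDist Ω) : ℝ) ≤ (⌈B⌉₊ + 1 : ℕ) := by exact_mod_cast hmix
    _ ≤ B + 2 := hceil
    _ ≤ (Real.log 16 + k + 2) * A * Real.log n := by rw [hB]; nlinarith

theorem card_torus (N d : ℕ) [NeZero N] : Fintype.card (Fin d → ZMod N) = N ^ d := by
  rw [Fintype.card_fun, ZMod.card, Fintype.card_fin]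

/-- Constant in the bound on the relaxation time. -/
def relaxationConst (c : ℝ) (k d : ℕ) : ℝ :=
  1 + omegaConst k d * ((k + 1) * (2 * d : ℕ)) * 2 / c

theorem one_le_relaxationConst {c : ℝ} (hc : 0 < c) (k d : ℕ) : 1 ≤ relaxationConst c k d := by
  have := omegaConst_nonneg k d
  unfold relaxationConst
  rw [le_add_iff_nonneg_right]
  positivity

theorem mixingTime_torus_le {c : ℝ} (hc : 0 < c) {N d k : ℕ} [NeZero N] (hd : 3 ≤ d)
    (hN : k * (3 * k + 1) < N) (hN2 : 3 ≤ N) (hcN : 2 * c ≤ N) (hkN : 4 * d * k ≤ N) :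
    (mixingTime (traceKernel (torusGraph N d) (c / ((N ^ d : ℕ) : ℝ)) k)
        (unifDist (OmegaK (torusGraph N d) k)) : ℝ) ≤
      (Real.log 16 + k + 2) * (relaxationConst c k d * ((N : ℝ) ^ 2 * ((N ^ d : ℕ) : ℝ) ^ 2)) *
        Real.log ((N ^ d : ℕ) : ℝ) := by
  have hNn : N ≤ N ^ d := Nat.le_self_pow (by omega) N
  have hn3 : (3 : ℝ) ≤ ((N ^ d : ℕ) : ℝ) := by exact_mod_cast hN2.trans hNn
  have hNn' : (N : ℝ) ≤ ((N ^ d : ℕ) : ℝ) := by exact_mod_cast hNn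
  have hdk : ((k * (2 * d : ℕ) : ℝ)) * 2 ≤ ((N ^ d : ℕ) : ℝ) := by
    have : k * (2 * d) * 2 ≤ N ^ d := le_trans (by linarith) (hkN.trans hNn)
    exact_mod_cast this
  have hcard : (Fintype.card (Fin d → ZMod N) : ℝ) = ((N ^ d : ℕ) : ℝ) := by rw [card_torus]
  have hΩ : (Fintype.card (OmegaK (torusGraph N d) k) : ℝ) ≤ ((N ^ d : ℕ) : ℝ) ^ k := by
    rw [← hcard]
    exact_mod_cast card_omegaK_le
  generalize ((N ^ d : ℕ) : ℝ) = n at *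
  have hn0 : 0 < n := by linarith
  have hp0 : 0 < c / n := div_pos hc hn0
  have hp2 : c / n ≤ 1 / 2 := by
    rw [div_le_div_iff₀ hn0 two_pos]
    linarith
  have hp1 : c / n < 1 := by linarith
  have hlog : 1 ≤ Real.log n := by
    rw [Real.le_log_iff_exp_le hn0]
    linarith [Real.exp_one_lt_d9]
  have hRC := one_le_relaxationConst hc k d
  have hN1 : (1 : ℝ) ≤ N := by exact_mod_cast (by omega : 1 ≤ N)
  refine mixingTime_le_log _ (traceKernel_nonneg _ _ hp0.le hp1.le k)
    (traceKernel_symm _ _ hp0 hp1 k) (traceKernel_row _ _ hp0.le hp1.le k) (fun x => ?_) _ ?_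
    (fun f => ?_) hlog hn0 hΩ
  · refine le_trans ?_ (traceKernel_self_ge _ _ hp0.le hp1.le k (2 * d) card_adj_torusGraph_le x)
    rw [hcard]
    have : ((k * (2 * d : ℕ) : ℝ)) / n ≤ 1 / 2 := by
      rw [div_le_div_iff₀ hn0 two_pos]
      linarith
    linarith
  · exact one_le_mul_of_one_le_of_one_le hRC
      (one_le_mul_of_one_le_of_one_le (one_le_pow₀ hN1) (one_le_pow₀ (by linarith)))
  · refine (omegaK_poincare hp0 hp1 hN (by omega) (by omega) f).trans ?_
    rw [hcard]
    have hC := omegaConst_nonneg k d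
    have hQ : 0 ≤ ∑ x, ∑ y, traceKernel (torusGraph N d) (c / n) k x y * (f x - f y) ^ 2 :=
      Finset.sum_nonneg fun x _ => Finset.sum_nonneg fun y _ =>
        mul_nonneg (traceKernel_nonneg _ _ hp0.le hp1.le k x y) (sq_nonneg _)
    refine mul_le_mul_of_nonneg_right (mul_le_mul_of_nonneg_right ?_ (Nat.cast_nonneg _)) hQ
    have h1 : c / n * (1 / 2) ≤ c / n * (1 - c / n) := by gcongr; linarith
    calc omegaConst k d * (N : ℝ) ^ 2 * ((k + 1) * (2 * d : ℕ) * n / (c / n * (1 - c / n)))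
        ≤ omegaConst k d * (N : ℝ) ^ 2 * ((k + 1) * (2 * d : ℕ) * n / (c / n * (1 / 2))) := by
          gcongr
      _ = omegaConst k d * ((k + 1) * (2 * d : ℕ)) * 2 / c * ((N : ℝ) ^ 2 * n ^ 2) := by
          field_simp
      _ ≤ relaxationConst c k d * ((N : ℝ) ^ 2 * n ^ 2) := by
          refine mul_le_mul_of_nonneg_right ?_ (by positivity)
          unfold relaxationConst
          linarith

theorem rpow_two_add_two_div (N d : ℕ) (hN : 0 < N) (hd : 0 < d) :
    ((N ^ d : ℕ) : ℝ) ^ ((2 : ℝ) + 2 / (d : ℝ)) = (N : ℝ) ^ 2 * ((N ^ d : ℕ) : ℝ) ^ 2 := by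
  have hd' : (d : ℝ) ≠ 0 := Nat.cast_ne_zero.mpr hd.ne'
  have hn : (0 : ℝ) < ((N ^ d : ℕ) : ℝ) := Nat.cast_pos.mpr (pow_pos hN d)
  rw [Real.rpow_add hn, Real.rpow_two, mul_comm]
  congr 1
  rw [Nat.cast_pow, ← Real.rpow_natCast (N : ℝ) d, ← Real.rpow_mul (Nat.cast_nonneg N),
    mul_div_cancel₀ _ hd', Real.rpow_two]

end Asymptotics

/-- Fix `0 < c`, `d ≥ 3` and `k ≥ 1`. For the KCIP on the torus `Λ(L+1,d)`
with `p = c/n`, `n = (L+1)^d`, the mixing time `τ_{n,k}` of the trace chain on `Ω_k`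
(with respect to its uniform stationary distribution) satisfies
`τ_{n,k} ≤ C n^{2+2/d} log n` for a constant `C` depending only on `c, k, d`. -/
theorem kcip_trace_mixing_time (c : ℝ) (hc : 0 < c) (d : ℕ) (hd : 3 ≤ d)
    (k : ℕ) (hk : 1 ≤ k) :
    ∃ C : ℝ, 0 < C ∧ ∃ L₀ : ℕ, ∀ L : ℕ, L₀ ≤ L →
      (mixingTime
          (traceKernel (torusGraph (L + 1) d) (c / (((L + 1) ^ d : ℕ) : ℝ)) k)
          (unifDist (OmegaK (torusGraph (L + 1) d) k)) : ℝ) ≤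
        C * (((L + 1) ^ d : ℕ) : ℝ) ^ ((2 : ℝ) + 2 / (d : ℝ)) *
          Real.log (((L + 1) ^ d : ℕ) : ℝ) := by
  have h16 : 0 < Real.log 16 := Real.log_pos (by norm_num)
  have hRC := one_le_relaxationConst hc k d
  refine ⟨(Real.log 16 + k + 2) * relaxationConst c k d, by positivity,
    k * (3 * k + 1) + ⌈2 * c⌉₊ + 4 * d * k + 2, fun L hL => ?_⟩
  have hcL : 2 * c ≤ ((L + 1 : ℕ) : ℝ) :=
    (Nat.le_ceil _).trans (by exact_mod_cast (by omega : ⌈2 * c⌉₊ ≤ L + 1))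
  rw [rpow_two_add_two_div (L + 1) d (Nat.succ_pos L) (by omega), mul_assoc (_ * _) (_ * _)]
  refine (mixingTime_torus_le hc hd (by omega) (by omega) hcL (by omega)).trans (le_of_eq ?_)
  ring
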